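/- arXiv:1306.4967 — 3 statements merged into one kernel-verified Lean document; each statement's English description precedes it below -/
import Mathlib

section
/- Let ℏ > 0 and N ≥ 2. If G ∈ 𝒮(ℝ^{N−1} × ℝ) is a Schwartz function, then the function x ∈ ℝ^{N−2} ↦ ∫_{ℝ^{N−1}×ℝ} G(z, y) Λ^{(N−1)}_y(z | x) dz dy belongs to 𝒮(ℝ^{N−2}), where Λ^{(N−1)}_y(z | x) = e^{(iy/2ℏ)(z₁+z_{N−1})} ∏_{n=1}^{N−2} V_{y,−}(z_n − x_n) ∏_{n=2}^{N−1} V_{y,+}(z_n − x_{n−1}). -/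
open MeasureTheory Real Complex SchwartzMap

noncomputable def Vplus (ℏ : ℝ) (lam : ℂ) (x : ℝ) : ℂ :=
  Complex.exp (↑(-(1 / ℏ) * Real.exp x) + Complex.I * lam * ↑x / (2 * ↑ℏ))

noncomputable def Vminus (ℏ : ℝ) (lam : ℂ) (x : ℝ) : ℂ :=
  Complex.exp (↑(-(1 / ℏ) * Real.exp (-x)) + Complex.I * lam * ↑x / (2 * ↑ℏ))

/-- The kernel `Λ^{(n+2)}_y(x | τ)` of the raising operator. -/
noncomputable def LamKer (ℏ : ℝ) (n : ℕ) (y : ℂ) (x : Fin (n + 2) → ℝ)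
    (τ : Fin (n + 1) → ℝ) : ℂ :=
  Complex.exp (Complex.I * y / (2 * ↑ℏ) * (↑(x 0) + ↑(x (Fin.last (n + 1)))))
    * (∏ k : Fin (n + 1), Vminus ℏ y (x k.castSucc - τ k))
    * ∏ k : Fin (n + 1), Vplus ℏ y (x k.succ - τ k)

section ParametricSchwartz

variable {P E V : Type*} [NormedAddCommGroup P] [NormedSpace ℝ P]
  [NormedAddCommGroup E] [NormedSpace ℝ E] [NormedAddCommGroup V] [NormedSpace ℝ V]

/-- A jointly smooth kernel all of whose derivatives in `x`, multiplied by any power of the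
weight `w x`, are dominated by an integrable function of the parameter. -/
structure IsDominatedKernel [MeasurableSpace P] (μ : Measure P) (w : E → ℝ) (K : P → E → V) :
    Prop where
  contDiff : ContDiff ℝ ((⊤ : ℕ∞) : WithTop ℕ∞) (Function.uncurry K)
  bound : ∀ m N : ℕ, ∃ b : P → ℝ, Integrable b μ ∧
    ∀ p x, w x ^ N * ‖iteratedFDeriv ℝ m (K p) x‖ ≤ b p

/-- A jointly smooth kernel all of whose derivatives in `x`, multiplied by any power of the
weight `w x`, grow at most polynomially in the parameter. -/
structure IsModerateKernel (w : E → ℝ) (K : P → E → V) : Prop where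
  contDiff : ContDiff ℝ ((⊤ : ℕ∞) : WithTop ℕ∞) (Function.uncurry K)
  bound : ∀ m N : ℕ, ∃ C : ℝ, ∃ M : ℕ, 0 ≤ C ∧
    ∀ p x, w x ^ N * ‖iteratedFDeriv ℝ m (K p) x‖ ≤ C * (1 + ‖p‖) ^ M

theorem contDiff_section {K : P → E → V} {n : WithTop ℕ∞}
    (h : ContDiff ℝ n (Function.uncurry K)) (p : P) : ContDiff ℝ n (K p) :=
  h.comp (contDiff_const.prodMk contDiff_id)

theorem contDiff_uncurry_fderiv {K : P → E → V}
    (h : ContDiff ℝ ((⊤ : ℕ∞) : WithTop ℕ∞) (Function.uncurry K)) :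
    ContDiff ℝ ((⊤ : ℕ∞) : WithTop ℕ∞) (Function.uncurry fun p x => fderiv ℝ (K p) x) := by
  have h' : ContDiff ℝ ((⊤ : ℕ∞) : WithTop ℕ∞)
      (Function.uncurry fun q : P × E => K q.1) :=
    h.comp ((contDiff_fst.comp contDiff_fst).prodMk contDiff_snd)
  exact h'.fderiv (g := fun q : P × E => q.2) contDiff_snd (by simp)

namespace IsDominatedKernel

variable [MeasurableSpace P] {μ : Measure P} {w : E → ℝ} {K : P → E → V}

theorem fderiv (h : IsDominatedKernel μ w K) :
    IsDominatedKernel μ w fun p x => fderiv ℝ (K p) x where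
  contDiff := contDiff_uncurry_fderiv h.contDiff
  bound m N := by
    obtain ⟨b, hb, hK⟩ := h.bound (m + 1) N
    refine ⟨b, hb, fun p x => ?_⟩
    rw [show (fun x => _root_.fderiv ℝ (K p) x) = _root_.fderiv ℝ (K p) from rfl,
      norm_iteratedFDeriv_fderiv]
    exact hK p x

theorem norm_iteratedFDeriv_le (h : IsDominatedKernel μ w K) (m : ℕ) :
    ∃ b : P → ℝ, Integrable b μ ∧ ∀ p x, ‖iteratedFDeriv ℝ m (K p) x‖ ≤ b p := by
  simpa using h.bound m 0

variable [BorelSpace P] [SecondCountableTopology P]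

theorem aestronglyMeasurable (h : IsDominatedKernel μ w K) (x : E) :
    AEStronglyMeasurable (fun p => K p x) μ :=
  (h.contDiff.continuous.comp (by fun_prop : Continuous fun p : P => (p, x))).aestronglyMeasurable

theorem integrable (h : IsDominatedKernel μ w K) (x : E) : Integrable (fun p => K p x) μ := by
  obtain ⟨b, hb, hK⟩ := h.norm_iteratedFDeriv_le 0
  exact hb.mono' (h.aestronglyMeasurable x) (.of_forall fun p => by simpa using hK p x)

theorem hasFDerivAt_integral (h : IsDominatedKernel μ w K) (x : E) :
    HasFDerivAt (fun x => ∫ p, K p x ∂μ) (∫ p, _root_.fderiv ℝ (K p) x ∂μ) x := by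
  obtain ⟨b, hb, hK⟩ := h.norm_iteratedFDeriv_le 1
  refine hasFDerivAt_integral_of_dominated_of_fderiv_le (s := Set.univ)
    (F := fun x p => K p x) (F' := fun x p => _root_.fderiv ℝ (K p) x) (bound := b)
    Filter.univ_mem (.of_forall h.aestronglyMeasurable) (h.integrable x)
    (h.fderiv.aestronglyMeasurable x) (.of_forall fun p y _ => ?_) hb
    (.of_forall fun p y _ => ?_)
  · simpa using hK p y
  · exact ((contDiff_section h.contDiff p).differentiable (by simp) y).hasFDerivAt

theorem fderiv_integral (h : IsDominatedKernel μ w K) :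
    _root_.fderiv ℝ (fun x => ∫ p, K p x ∂μ) = fun x => ∫ p, _root_.fderiv ℝ (K p) x ∂μ :=
  funext fun x => (h.hasFDerivAt_integral x).fderiv

end IsDominatedKernel

end ParametricSchwartz

section Integral

variable {P : Type*} [NormedAddCommGroup P] [NormedSpace ℝ P] [MeasurableSpace P] [BorelSpace P]
  [SecondCountableTopology P] {μ : Measure P}

universe u v

variable {E : Type u} [NormedAddCommGroup E] [NormedSpace ℝ E] {w : E → ℝ}

theorem IsDominatedKernel.contDiff_integral_nat (n : ℕ) :
    ∀ {V : Type (max u v)} [NormedAddCommGroup V] [NormedSpace ℝ V] {K : P → E → V},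
      IsDominatedKernel μ w K → ContDiff ℝ n fun x => ∫ p, K p x ∂μ := by
  induction n with
  | zero =>
    intro V _ _ K h
    exact contDiff_zero.2
      (continuous_iff_continuousAt.2 fun x => (h.hasFDerivAt_integral x).continuousAt)
  | succ n ih =>
    intro V _ _ K h
    exact contDiff_succ_iff_hasFDerivAt.2 ⟨_, ih h.fderiv, h.hasFDerivAt_integral⟩

theorem IsDominatedKernel.contDiff_integral {V : Type (max u v)} [NormedAddCommGroup V]
    [NormedSpace ℝ V] {K : P → E → V} (h : IsDominatedKernel μ w K) :
    ContDiff ℝ ((⊤ : ℕ∞) : WithTop ℕ∞) fun x => ∫ p, K p x ∂μ :=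
  contDiff_infty.2 fun n => contDiff_integral_nat.{u, v} n h

theorem IsDominatedKernel.iteratedFDeriv_integral_bound (hw : ∀ x, 0 ≤ w x) (m N : ℕ) :
    ∀ {V : Type (max u v)} [NormedAddCommGroup V] [NormedSpace ℝ V] {K : P → E → V},
      IsDominatedKernel μ w K →
        ∃ C, ∀ x, w x ^ N * ‖iteratedFDeriv ℝ m (fun x => ∫ p, K p x ∂μ) x‖ ≤ C := by
  induction m with
  | zero =>
    intro V _ _ K h
    obtain ⟨b, hb, hK⟩ := h.bound 0 N
    refine ⟨∫ p, b p ∂μ, fun x => ?_⟩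
    have hwx : 0 ≤ w x ^ N := pow_nonneg (hw x) N
    calc w x ^ N * ‖iteratedFDeriv ℝ 0 (fun x => ∫ p, K p x ∂μ) x‖
        ≤ w x ^ N * ∫ p, ‖K p x‖ ∂μ := by
          rw [norm_iteratedFDeriv_zero]
          gcongr
          exact norm_integral_le_integral_norm _
      _ = ∫ p, w x ^ N * ‖K p x‖ ∂μ := (integral_const_mul _ _).symm
      _ ≤ ∫ p, b p ∂μ :=
          integral_mono ((h.integrable x).norm.const_mul _) hb fun p => by simpa using hK p x
  | succ m ih =>
    intro V _ _ K h
    obtain ⟨C, hC⟩ := ih h.fderiv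
    refine ⟨C, fun x => ?_⟩
    rw [← norm_iteratedFDeriv_fderiv, h.fderiv_integral]
    exact hC x

/-- Integrating out the parameter of a dominated kernel gives a Schwartz function. -/
theorem IsDominatedKernel.exists_schwartzMap {V : Type (max u v)} [NormedAddCommGroup V]
    [NormedSpace ℝ V] {K : P → E → V} (h : IsDominatedKernel μ w K) (hw : ∀ x, ‖x‖ ≤ w x) :
    ∃ H : SchwartzMap E V, ∀ x, H x = ∫ p, K p x ∂μ := by
  refine ⟨⟨fun x => ∫ p, K p x ∂μ, contDiff_integral.{u, v} h, fun k m => ?_⟩, fun _ => rfl⟩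
  obtain ⟨C, hC⟩ := iteratedFDeriv_integral_bound.{u, v}
    (fun x => (norm_nonneg x).trans (hw x)) m k h
  refine ⟨C, fun x => le_trans ?_ (hC x)⟩
  gcongr
  exact hw x

end Integral

section Moderate

variable {P E : Type*} [NormedAddCommGroup P] [NormedSpace ℝ P]
  [NormedAddCommGroup E] [NormedSpace ℝ E]

namespace IsModerateKernel

theorem const_one : IsModerateKernel (fun _ : E => (1 : ℝ)) (fun (_ : P) (_ : E) => (1 : ℂ)) where
  contDiff := contDiff_const
  bound m N := by
    refine ⟨1, 0, zero_le_one, fun p x => ?_⟩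
    rcases m with _ | m
    · simp
    · simp [iteratedFDeriv_const_of_ne]

theorem mul {w w' : E → ℝ} {K K' : P → E → ℂ} (h : IsModerateKernel w K)
    (h' : IsModerateKernel w' K') (hw : ∀ x, 0 ≤ w x) (hw' : ∀ x, 0 ≤ w' x) :
    IsModerateKernel (fun x => w x * w' x) fun p x => K p x * K' p x where
  contDiff := h.contDiff.mul h'.contDiff
  bound m N := by
    choose C M hC hb using fun i => h.bound i N
    choose C' M' hC' hb' using fun i => h'.bound i N
    set M₀ := ∑ i ∈ Finset.range (m + 1), (M i + M' (m - i)) with hM₀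
    refine ⟨∑ i ∈ Finset.range (m + 1), m.choose i * (C i * C' (m - i)), M₀,
      Finset.sum_nonneg fun i _ => mul_nonneg (Nat.cast_nonneg _) (mul_nonneg (hC _) (hC' _)),
      fun p x => ?_⟩
    have hx : 0 ≤ (w x * w' x) ^ N := pow_nonneg (mul_nonneg (hw x) (hw' x)) N
    refine (mul_le_mul_of_nonneg_left (norm_iteratedFDeriv_mul_le (n := m)
      (contDiff_section h.contDiff p) (contDiff_section h'.contDiff p) x
      (by exact_mod_cast le_top)) hx).trans ?_
    rw [Finset.mul_sum, Finset.sum_mul]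
    refine Finset.sum_le_sum fun i hi => ?_
    have h1 := hb i p x
    have h2 := hb' (m - i) p x
    have hw'N : 0 ≤ w' x ^ N := pow_nonneg (hw' x) N
    have hp : 1 ≤ 1 + ‖p‖ := le_add_of_nonneg_right (norm_nonneg p)
    calc (w x * w' x) ^ N * (m.choose i * ‖iteratedFDeriv ℝ i (K p) x‖
            * ‖iteratedFDeriv ℝ (m - i) (K' p) x‖)
        = m.choose i * ((w x ^ N * ‖iteratedFDeriv ℝ i (K p) x‖)
            * (w' x ^ N * ‖iteratedFDeriv ℝ (m - i) (K' p) x‖)) := by rw [mul_pow]; ring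
      _ ≤ m.choose i * ((C i * (1 + ‖p‖) ^ M i) * (C' (m - i) * (1 + ‖p‖) ^ M' (m - i))) := by
          gcongr
          exact mul_nonneg (hC i) (by positivity)
      _ = m.choose i * (C i * C' (m - i)) * (1 + ‖p‖) ^ (M i + M' (m - i)) := by
          rw [pow_add]; ring
      _ ≤ m.choose i * (C i * C' (m - i)) * (1 + ‖p‖) ^ M₀ := by
          have := mul_nonneg (hC i) (hC' (m - i))
          gcongr
          exact Finset.single_le_sum (f := fun i => M i + M' (m - i))
            (fun _ _ => Nat.zero_le _) hi

theorem prod {ι : Type*} (s : Finset ι) {w : ι → E → ℝ} {K : ι → P → E → ℂ}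
    (h : ∀ i ∈ s, IsModerateKernel (w i) (K i)) (hw : ∀ i x, 0 ≤ w i x) :
    IsModerateKernel (fun x => ∏ i ∈ s, w i x) fun p x => ∏ i ∈ s, K i p x := by
  classical
  induction s using Finset.induction_on with
  | empty => simpa using const_one
  | insert a s ha ih =>
    simp only [Finset.prod_insert ha]
    exact (h a (Finset.mem_insert_self a s)).mul
      (ih fun i hi => h i (Finset.mem_insert_of_mem hi)) (hw a)
      fun x => Finset.prod_nonneg fun i _ => hw i x

/-- A one-variable function with rapid decay relative to `v`, composed with an affine function
of `x` depending on the parameter. -/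
theorem comp_affine {f : ℝ → ℂ} {v : ℝ → ℝ} {w : E → ℝ} {L : P → E →L[ℝ] ℝ} {c : P → ℝ} {A : ℝ}
    (hf : ContDiff ℝ ((⊤ : ℕ∞) : WithTop ℕ∞) f)
    (hfb : ∀ m N : ℕ, ∃ C, ∀ t, v t ^ N * ‖iteratedDeriv m f t‖ ≤ C)
    (hL : ContDiff ℝ ((⊤ : ℕ∞) : WithTop ℕ∞) L) (hc : ContDiff ℝ ((⊤ : ℕ∞) : WithTop ℕ∞) c)
    (hLA : ∀ p, ‖L p‖ ≤ A * (1 + ‖p‖)) (hw : ∀ x, 0 ≤ w x) (hv : ∀ t, 0 ≤ v t)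
    (hwv : ∀ p x, w x ≤ v (L p x + c p) * (1 + ‖p‖)) :
    IsModerateKernel w fun p x => f (L p x + c p) where
  contDiff := hf.comp (((hL.comp contDiff_fst).clm_apply contDiff_snd).add
    (hc.comp contDiff_fst))
  bound m N := by
    obtain ⟨C, hC⟩ := hfb m N
    have hC0 : 0 ≤ C := (mul_nonneg (pow_nonneg (hv 0) N) (norm_nonneg _)).trans (hC 0)
    have hA : 0 ≤ A := by simpa using (norm_nonneg _).trans (hLA 0)
    refine ⟨C * A ^ m, N + m, by positivity, fun p x => ?_⟩
    have hder : ‖iteratedFDeriv ℝ m (fun x => f (L p x + c p)) x‖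
        ≤ ‖iteratedDeriv m f (L p x + c p)‖ * ‖L p‖ ^ m := by
      have hg : ContDiff ℝ ((⊤ : ℕ∞) : WithTop ℕ∞) fun t => f (t + c p) :=
        hf.comp (contDiff_id.add contDiff_const)
      have := (L p).iteratedFDeriv_comp_right hg x (i := m) (by exact_mod_cast le_top)
      rw [show (fun x => f (L p x + c p)) = (fun t => f (t + c p)) ∘ L p from rfl, this,
        iteratedFDeriv_comp_add_right]
      refine (ContinuousMultilinearMap.norm_compContinuousLinearMap_le _ _).trans ?_
      simp [norm_iteratedFDeriv_eq_norm_iteratedDeriv]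
    have hvt := hv (L p x + c p)
    have hwx := hw x
    calc w x ^ N * ‖iteratedFDeriv ℝ m (fun x => f (L p x + c p)) x‖
        ≤ (v (L p x + c p) * (1 + ‖p‖)) ^ N *
          (‖iteratedDeriv m f (L p x + c p)‖ * (A * (1 + ‖p‖)) ^ m) := by
          refine mul_le_mul (pow_le_pow_left₀ hwx (hwv p x) N) (hder.trans ?_)
            (norm_nonneg _) (by positivity)
          gcongr
          exact hLA p
      _ = (v (L p x + c p) ^ N * ‖iteratedDeriv m f (L p x + c p)‖) *
          (A ^ m * (1 + ‖p‖) ^ (N + m)) := by rw [mul_pow, mul_pow, pow_add]; ring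
      _ ≤ C * (A ^ m * (1 + ‖p‖) ^ (N + m)) := by
          gcongr
          exact hC _
      _ = C * A ^ m * (1 + ‖p‖) ^ (N + m) := by ring

/-- Multiplying a moderate kernel by a Schwartz function of the parameter makes it dominated. -/
theorem schwartz_mul [MeasurableSpace P] [BorelSpace P] [SecondCountableTopology P]
    {μ : Measure P} [μ.HasTemperateGrowth] {w : E → ℝ} {K : P → E → ℂ}
    (h : IsModerateKernel w K) (hw : ∀ x, 0 ≤ w x) (G : SchwartzMap P ℂ) :
    IsDominatedKernel μ w fun p x => G p * K p x where
  contDiff := ((G.smooth ⊤).comp contDiff_fst).mul h.contDiff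
  bound m N := by
    obtain ⟨C, M, hC, hb⟩ := h.bound m N
    refine ⟨fun p => C * 2 ^ (M - 1) * (‖p‖ ^ 0 * ‖G p‖ + ‖p‖ ^ M * ‖G p‖),
      ((G.integrable_pow_mul μ 0).add (G.integrable_pow_mul μ M)).const_mul _, fun p x => ?_⟩
    have hwx : 0 ≤ w x ^ N := pow_nonneg (hw x) N
    have hK : ‖iteratedFDeriv ℝ m (fun x => G p * K p x) x‖
        = ‖G p‖ * ‖iteratedFDeriv ℝ m (K p) x‖ := by
      have := iteratedFDeriv_const_smul_apply (𝕜 := ℝ) (a := G p) (i := m) (x := x)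
        (((contDiff_section h.contDiff p).of_le (by exact_mod_cast le_top)).contDiffAt)
      rw [show (fun x => G p * K p x) = G p • K p from rfl, this, norm_smul]
    rw [hK]
    calc w x ^ N * (‖G p‖ * ‖iteratedFDeriv ℝ m (K p) x‖)
        = ‖G p‖ * (w x ^ N * ‖iteratedFDeriv ℝ m (K p) x‖) := by ring
      _ ≤ ‖G p‖ * (C * (1 + ‖p‖) ^ M) :=
          mul_le_mul_of_nonneg_left (hb p x) (norm_nonneg _)
      _ ≤ ‖G p‖ * (C * (2 ^ (M - 1) * (1 ^ M + ‖p‖ ^ M))) := by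
          gcongr
          exact add_pow_le zero_le_one (norm_nonneg p) M
      _ = C * 2 ^ (M - 1) * (‖p‖ ^ 0 * ‖G p‖ + ‖p‖ ^ M * ‖G p‖) := by
          rw [one_pow, pow_zero]; ring

end IsModerateKernel

end Moderate

section DoubleExp

open Polynomial in
theorem exists_polynomial_mul_exp_neg_le {ℏ : ℝ} (hℏ : 0 < ℏ) (Q : ℝ[X]) :
    ∃ C, ∀ u, 0 ≤ u → |Q.eval u| * Real.exp (-(1 / ℏ) * u) ≤ C := by
  induction Q using Polynomial.induction_on' with
  | add p q hp hq =>
    obtain ⟨C, hC⟩ := hp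
    obtain ⟨D, hD⟩ := hq
    refine ⟨C + D, fun u hu => le_trans ?_ (add_le_add (hC u hu) (hD u hu))⟩
    rw [← add_mul, eval_add]
    gcongr
    exact abs_add_le _ _
  | monomial k a =>
    refine ⟨|a| * (ℏ ^ k * k.factorial), fun u hu => ?_⟩
    have h := Real.pow_div_factorial_le_exp (u / ℏ) (by positivity) k
    rw [div_le_iff₀ (by positivity), div_pow, div_le_iff₀ (by positivity)] at h
    rw [eval_monomial, abs_mul, abs_of_nonneg (pow_nonneg hu k), mul_assoc,
      show -(1 / ℏ) * u = -(u / ℏ) by ring, Real.exp_neg]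
    refine mul_le_mul_of_nonneg_left ?_ (abs_nonneg a)
    rw [← div_eq_mul_inv, div_le_iff₀ (Real.exp_pos _)]
    linarith

open Polynomial in
theorem iteratedDeriv_cexp_neg_exp (ℏ : ℝ) (m : ℕ) :
    ∃ Q : ℝ[X], iteratedDeriv m (fun t : ℝ => Complex.exp (↑(-(1 / ℏ) * Real.exp t)))
      = fun t => ((Q.eval (Real.exp t) * Real.exp (-(1 / ℏ) * Real.exp t) : ℝ) : ℂ) := by
  induction m with
  | zero => exact ⟨1, by simp⟩
  | succ m ih =>
    obtain ⟨Q, hQ⟩ := ih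
    refine ⟨X * derivative Q - C (1 / ℏ) * X * Q, ?_⟩
    rw [iteratedDeriv_succ, hQ]
    funext t
    have h1 := (Q.hasDerivAt (Real.exp t)).comp t (Real.hasDerivAt_exp t)
    have h2 := ((Real.hasDerivAt_exp t).const_mul (-(1 / ℏ))).exp
    refine (h1.mul h2).ofReal_comp.deriv.trans ?_
    congr 1
    simp only [Function.comp_apply, eval_sub, eval_mul, eval_X, eval_C]
    ring

theorem cexp_neg_exp_decay {ℏ : ℝ} (hℏ : 0 < ℏ) (m N : ℕ) :
    ∃ C, ∀ t : ℝ, (1 + Real.exp t) ^ N *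
      ‖iteratedDeriv m (fun t : ℝ => Complex.exp (↑(-(1 / ℏ) * Real.exp t))) t‖ ≤ C := by
  obtain ⟨Q, hQ⟩ := iteratedDeriv_cexp_neg_exp ℏ m
  obtain ⟨C, hC⟩ := exists_polynomial_mul_exp_neg_le hℏ ((1 + Polynomial.X) ^ N * Q)
  refine ⟨C, fun t => le_trans (le_of_eq ?_) (hC (Real.exp t) (Real.exp_pos t).le)⟩
  rw [hQ, Complex.norm_real, Real.norm_eq_abs, abs_mul, abs_of_pos (Real.exp_pos _)]
  simp [abs_mul, abs_of_pos (show 0 < 1 + Real.exp t by positivity), mul_assoc]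

theorem contDiff_cexp_neg_exp (ℏ : ℝ) :
    ContDiff ℝ ((⊤ : ℕ∞) : WithTop ℕ∞)
      fun t : ℝ => Complex.exp (↑(-(1 / ℏ) * Real.exp t)) :=
  (Complex.ofRealCLM.contDiff.comp (contDiff_const.mul Real.contDiff_exp)).cexp

theorem iteratedDeriv_cexp_I_mul (m : ℕ) :
    iteratedDeriv m (fun t : ℝ => Complex.exp (Complex.I * t))
      = fun t : ℝ => Complex.I ^ m * Complex.exp (Complex.I * t) := by
  induction m with
  | zero => simp
  | succ m ih =>
    rw [iteratedDeriv_succ, ih]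
    funext t
    have h := (((hasDerivAt_id t).ofReal_comp.const_mul Complex.I).cexp.const_mul
      (Complex.I ^ m)).deriv
    simp only [id] at h
    rw [h]
    push_cast
    ring

end DoubleExp

/-- A double exponential factor with argument `L x + ℓ p` decays in the direction `L x → +∞`. -/
theorem isModerateKernel_cexp_neg_exp {P E : Type*} [NormedAddCommGroup P] [NormedSpace ℝ P]
    [NormedAddCommGroup E] [NormedSpace ℝ E] {ℏ : ℝ} (hℏ : 0 < ℏ) (L : E →L[ℝ] ℝ)
    (ℓ : P →L[ℝ] ℝ) (hℓ : ∀ p, |ℓ p| ≤ ‖p‖) :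
    IsModerateKernel (fun x => 1 + max (L x) 0)
      fun (p : P) x => Complex.exp (↑(-(1 / ℏ) * Real.exp (L x + ℓ p))) := by
  refine IsModerateKernel.comp_affine (v := fun t => 1 + Real.exp t) (L := fun _ : P => L)
    (c := ℓ) (A := ‖L‖) (contDiff_cexp_neg_exp ℏ) (cexp_neg_exp_decay hℏ) contDiff_const
    ℓ.contDiff (fun p => ?_) (fun x => ?_) (fun t => by positivity) fun p x => ?_
  · exact le_mul_of_one_le_right (norm_nonneg _) (le_add_of_nonneg_right (norm_nonneg p))
  · positivity
  · have h1 := Real.add_one_le_exp (L x + ℓ p)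
    have h2 := neg_le_of_abs_le (hℓ p)
    have h3 := norm_nonneg p
    have h4 := mul_nonneg (Real.exp_pos (L x + ℓ p)).le h3
    have h5 := Real.exp_pos (L x + ℓ p)
    rcases max_cases (L x) 0 with h | h <;> rw [h.1] <;> nlinarith

theorem lamKer_eq (ℏ : ℝ) (n : ℕ) (y : ℝ) (z : Fin (n + 2) → ℝ) (x : Fin (n + 1) → ℝ) :
    LamKer ℏ n y z x =
      Complex.exp (Complex.I * ↑(-(y / ℏ) * ∑ k, x k + y / ℏ * ∑ k, z k)) *
        ∏ k : Fin (n + 1), Complex.exp (↑(-(1 / ℏ) * Real.exp (x k + -z k.castSucc))) *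
          Complex.exp (↑(-(1 / ℏ) * Real.exp (-x k + z k.succ))) := by
  have h1 := Fin.sum_univ_succ z
  have h2 := Fin.sum_univ_castSucc z
  have hz : (z 0 : ℂ) + z (Fin.last (n + 1)) + (∑ k : Fin (n + 1), (z k.castSucc : ℂ) +
      ∑ k : Fin (n + 1), (z k.succ : ℂ)) = 2 * ∑ k, (z k : ℂ) := by
    have : z 0 + z (Fin.last (n + 1)) + (∑ k : Fin (n + 1), z k.castSucc +
      ∑ k : Fin (n + 1), z k.succ) = 2 * ∑ k, z k := by linarith
    exact_mod_cast congrArg ((↑) : ℝ → ℂ) this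
  unfold LamKer Vplus Vminus
  simp only [← Complex.exp_add, ← Complex.exp_sum, Finset.sum_add_distrib]
  congr 1
  have e1 : ∀ k : Fin (n + 1), -(z k.castSucc - x k) = x k + -z k.castSucc := fun k => by ring
  have e2 : ∀ k : Fin (n + 1), z k.succ - x k = -x k + z k.succ := fun k => by ring
  have e3 : ∀ a : Fin (n + 1) → ℝ, ∑ k, Complex.I * (y : ℂ) * ((a k : ℝ) : ℂ) / (2 * (ℏ : ℂ))
      = Complex.I * y / (2 * ℏ) * ∑ k, (a k : ℂ) := fun a => by
    rw [Finset.mul_sum]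
    exact Finset.sum_congr rfl fun k _ => by ring
  rw [e3 (fun k => z k.castSucc - x k), e3 (fun k => z k.succ - x k)]
  simp only [e1, e2]
  push_cast
  simp only [Finset.sum_add_distrib, Finset.sum_sub_distrib, Finset.sum_neg_distrib]
  linear_combination Complex.I * y / (2 * ℏ) * hz

theorem norm_le_prod_weight {ι : Type*} [Fintype ι] (x : ι → ℝ) :
    ‖x‖ ≤ ∏ k, (1 + max (x k) 0) * (1 + max (-x k) 0) := by
  have h1 : ∀ k, 1 ≤ (1 + max (x k) 0) * (1 + max (-x k) 0) := fun k =>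
    one_le_mul_of_one_le_of_one_le (by simp) (by simp)
  refine (pi_norm_le_iff_of_nonneg
    (Finset.prod_nonneg fun k _ => zero_le_one.trans (h1 k))).2 fun k => ?_
  have hsingle := Finset.prod_le_prod_of_subset_of_one_le (Finset.subset_univ {k})
    (fun i _ => zero_le_one.trans (h1 i)) fun i _ _ => h1 i
  rw [Finset.prod_singleton] at hsingle
  refine le_trans ?_ hsingle
  rw [Real.norm_eq_abs]
  rcases abs_cases (x k) with h | h
  · rw [h.1, max_eq_left h.2, max_eq_right (by linarith)]; linarith
  · rw [h.1, max_eq_right h.2.le, max_eq_left (by linarith)]; linarith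

theorem isModerateKernel_phase (ℏ : ℝ) (n : ℕ) :
    IsModerateKernel (fun _ : Fin (n + 1) → ℝ => (1 : ℝ))
      fun (p : (Fin (n + 2) → ℝ) × ℝ) x =>
        Complex.exp (Complex.I * ↑(-(p.2 / ℏ) * ∑ k, x k + p.2 / ℏ * ∑ k, p.1 k)) := by
  set S : (Fin (n + 1) → ℝ) →L[ℝ] ℝ := ∑ k, ContinuousLinearMap.proj k with hS
  have key := IsModerateKernel.comp_affine (P := (Fin (n + 2) → ℝ) × ℝ)
    (f := fun t : ℝ => Complex.exp (Complex.I * t)) (v := fun _ => 1) (w := fun _ => 1)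
    (L := fun p => (-(p.2 / ℏ)) • S) (c := fun p => p.2 / ℏ * ∑ k, p.1 k) (A := |ℏ⁻¹| * ‖S‖)
    (contDiff_const.mul Complex.ofRealCLM.contDiff).cexp (fun m N => ⟨1, fun t => ?_⟩)
    ((contDiff_snd.div_const ℏ).neg.smul contDiff_const) (by fun_prop) (fun p => ?_)
    (fun _ => zero_le_one) (fun _ => zero_le_one) (fun p x => ?_)
  · simpa [hS] using key
  · rw [iteratedDeriv_cexp_I_mul]
    simp [Complex.norm_exp]
  · have hp : |p.2| ≤ 1 + ‖p‖ := by
      have : |p.2| ≤ ‖p‖ := norm_snd_le p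
      linarith
    rw [norm_smul, norm_neg, Real.norm_eq_abs, div_eq_mul_inv, abs_mul]
    calc |p.2| * |ℏ⁻¹| * ‖S‖ = |ℏ⁻¹| * ‖S‖ * |p.2| := by ring
      _ ≤ |ℏ⁻¹| * ‖S‖ * (1 + ‖p‖) := by gcongr
  · simp

theorem isModerateKernel_lamKer {ℏ : ℝ} (hℏ : 0 < ℏ) (n : ℕ) :
    IsModerateKernel (fun x : Fin (n + 1) → ℝ => ∏ k, (1 + max (x k) 0) * (1 + max (-x k) 0))
      fun (p : (Fin (n + 2) → ℝ) × ℝ) x => LamKer ℏ n (↑p.2) p.1 x := by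
  have hcoord : ∀ (p : (Fin (n + 2) → ℝ) × ℝ) j, |p.1 j| ≤ ‖p‖ := fun p j =>
    (norm_le_pi_norm p.1 j).trans (norm_fst_le p)
  let z (j : Fin (n + 2)) : (Fin (n + 2) → ℝ) × ℝ →L[ℝ] ℝ :=
    (ContinuousLinearMap.proj j).comp (ContinuousLinearMap.fst ℝ _ _)
  let X (k : Fin (n + 1)) : (Fin (n + 1) → ℝ) →L[ℝ] ℝ := ContinuousLinearMap.proj k
  have hprod := IsModerateKernel.prod Finset.univ
    (fun k _ => (isModerateKernel_cexp_neg_exp hℏ (X k) (-z k.castSucc)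
      (fun p => by simpa [z] using hcoord p k.castSucc)).mul
      (isModerateKernel_cexp_neg_exp hℏ (-X k) (z k.succ) (fun p => hcoord p k.succ))
      (fun x => by positivity) (fun x => by positivity)) (fun k x => by positivity)
  have h := (isModerateKernel_phase ℏ n).mul hprod (fun _ => zero_le_one)
    (fun x => Finset.prod_nonneg fun k _ => by positivity)
  simp only [one_mul] at h
  simp only [lamKer_eq]
  exact h

/-- If `G ∈ 𝒮(ℝ^{N-1} × ℝ)` then
`x ↦ ∫ G(z,y) Λ^{(N-1)}_y(z | x) dz dy` belongs to `𝒮(ℝ^{N-2})` (here `N-1 = n+2`). -/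
theorem lam_left_action_schwartz (ℏ : ℝ) (hℏ : 0 < ℏ) (n : ℕ)
    (G : SchwartzMap ((Fin (n + 2) → ℝ) × ℝ) ℂ) :
    ∃ H : SchwartzMap (Fin (n + 1) → ℝ) ℂ,
      ∀ x : Fin (n + 1) → ℝ,
        H x = ∫ p : (Fin (n + 2) → ℝ) × ℝ, G p * LamKer ℏ n (↑p.2) p.1 x := by
  have : (volume : Measure ((Fin (n + 2) → ℝ) × ℝ)).IsAddHaarMeasure :=
    Measure.prod.instIsAddHaarMeasure _ _
  have hw : ∀ x : Fin (n + 1) → ℝ, ‖x‖ ≤ ∏ k, (1 + max (x k) 0) * (1 + max (-x k) 0) :=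
    norm_le_prod_weight
  exact ((isModerateKernel_lamKer hℏ n).schwartz_mul
    (fun x => (norm_nonneg x).trans (hw x)) G).exists_schwartzMap hw
end

section
/- Gustafson's Toda-like limit integral: for ℏ > 0, s ∈ ℝ, generic complex parameters y₁,…,y_n and x₁,…,x_{n−1}, and a contour 𝒞 separating the upward lattices {y_a + iℏ𝐍} from the downward lattices {x_a − iℏ𝐍} (passing below the former and above the latter), one has ∫_{𝒞^n} e^{s (w₁+…+w_n)/(iℏ)} · [∏_{a=1}^{n} ∏_{b=1}^{n} Γ((y_b − w_a)/(iℏ)) · ∏_{a=1}^{n} ∏_{b=1}^{n−1} Γ((w_a − x_b)/(iℏ))] / ∏_{a≠b} Γ((w_a − w_b)/(iℏ)) · d^n w/(2πℏ)^n = n! · e^{s(y₁+…+y_n)/(iℏ)} · e^{−e^s} · ∏_{a=1}^{n} ∏_{b=1}^{n−1} Γ((y_a − x_b)/(iℏ)). -/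
open MeasureTheory Real Complex Finset

section

open Filter Asymptotics Topology
open scoped Polynomial

theorem norm_betaIntegral_le (u v : ℂ) :
    ‖betaIntegral u v‖ ≤ ‖betaIntegral u.re v.re‖ := by
  have key : betaIntegral u.re v.re
      = ((∫ x in (0 : ℝ)..1, x ^ (u.re - 1) * (1 - x) ^ (v.re - 1) : ℝ) : ℂ) := by
    rw [betaIntegral, ← intervalIntegral.integral_ofReal]
    refine intervalIntegral.integral_congr fun x hx => ?_
    rw [Set.uIcc_of_le zero_le_one] at hx
    simp only [ofReal_mul]
    rw [ofReal_cpow hx.1, ofReal_cpow (by linarith [hx.2])]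
    push_cast
    rfl
  rw [key, Complex.norm_real, Real.norm_eq_abs]
  refine le_trans ?_ (le_abs_self _)
  rw [betaIntegral]
  refine (intervalIntegral.norm_integral_le_integral_norm zero_le_one).trans (le_of_eq ?_)
  refine intervalIntegral.integral_congr_ae ?_
  have h1 : ∀ᵐ x : ℝ, x ≠ 1 := Measure.ae_ne volume 1
  filter_upwards [h1] with x hx1 hx
  rw [Set.uIoc_of_le zero_le_one] at hx
  have hx2 : 0 < 1 - x := by
    rcases lt_or_eq_of_le hx.2 with h | h
    · linarith
    · exact absurd h hx1
  rw [norm_mul, Complex.norm_cpow_eq_rpow_re_of_pos hx.1]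
  have : (1 - (x : ℂ)) = ((1 - x : ℝ) : ℂ) := by push_cast; rfl
  rw [this, Complex.norm_cpow_eq_rpow_re_of_pos hx2]
  simp

theorem norm_Gamma_le_of_re_lt {z : ℂ} {b : ℝ} (hz : 0 < z.re) (hb : 0 < b) :
    ‖Complex.Gamma z‖ ≤ Real.Gamma z.re / Real.Gamma (z.re + b) * ‖Complex.Gamma (z + b)‖ := by
  have h1 := Complex.Gamma_mul_Gamma_eq_betaIntegral (s := z) (t := b) hz (by simpa using hb)
  have h2 := Complex.Gamma_mul_Gamma_eq_betaIntegral (s := (z.re : ℂ)) (t := b)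
    (by simpa using hz) (by simpa using hb)
  have h3 := norm_betaIntegral_le z b
  have g1 := Real.Gamma_pos_of_pos hz
  have g2 := Real.Gamma_pos_of_pos hb
  have g3 := Real.Gamma_pos_of_pos (add_pos hz hb)
  have h1' := congrArg norm h1
  have h2' := congrArg norm h2
  rw [norm_mul, norm_mul] at h1' h2'
  rw [← ofReal_add, Complex.Gamma_ofReal, Complex.Gamma_ofReal, Complex.Gamma_ofReal,
    Complex.norm_real, Complex.norm_real, Complex.norm_real, Real.norm_of_nonneg g1.le,
    Real.norm_of_nonneg g2.le, Real.norm_of_nonneg g3.le] at h2'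
  rw [Complex.Gamma_ofReal, Complex.norm_real, Real.norm_of_nonneg g2.le] at h1'
  rw [ofReal_re] at h3
  have : ‖betaIntegral z.re b‖ = Real.Gamma z.re * Real.Gamma b / Real.Gamma (z.re + b) := by
    field_simp; linarith
  rw [this] at h3
  refine le_of_mul_le_mul_right ?_ g2
  rw [h1']
  calc _ ≤ ‖Complex.Gamma (z + b)‖ * (Real.Gamma z.re * Real.Gamma b / Real.Gamma (z.re + b)) := by
        gcongr
    _ = _ := by ring

theorem norm_Gamma_half_add_mul_I_le (t : ℝ) :
    ‖Complex.Gamma (1 / 2 + t * I)‖ ≤ √(2 * π) * Real.exp (-(π / 2) * |t|) := by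
  have h1 : Complex.Gamma (1 / 2 + t * I) * Complex.Gamma (1 - (1 / 2 + t * I))
      = π / Complex.sin (π * (1 / 2 + t * I)) := Complex.Gamma_mul_Gamma_one_sub _
  have h2 : (1 : ℂ) - (1 / 2 + t * I) = (starRingEnd ℂ) (1 / 2 + t * I) := by
    simp [Complex.ext_iff]; norm_num
  have h3 : Complex.sin (π * (1 / 2 + t * I)) = (Real.cosh (π * t) : ℂ) := by
    rw [show (π : ℂ) * (1 / 2 + t * I) = (π * t : ℂ) * I + π / 2 by ring,
      Complex.sin_add_pi_div_two, Complex.cos_mul_I]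
    push_cast; rfl
  rw [h2, Complex.Gamma_conj, h3, Complex.mul_conj, Complex.normSq_eq_norm_sq] at h1
  have h4 : ‖Complex.Gamma (1 / 2 + t * I)‖ ^ 2 = π / Real.cosh (π * t) := by exact_mod_cast h1
  have h5 : Real.exp (π * |t|) / 2 ≤ Real.cosh (π * t) := by
    rw [← Real.cosh_abs, abs_mul, abs_of_pos pi_pos, Real.cosh_eq]
    have := Real.exp_pos (-(π * |t|))
    linarith
  refine abs_le_of_sq_le_sq' ?_ (by positivity) |>.2
  rw [h4, mul_pow, Real.sq_sqrt (by positivity), ← Real.exp_nat_mul]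
  rw [div_le_iff₀ (Real.cosh_pos _)]
  calc π = 2 * π * Real.exp (-(π * |t|)) * (Real.exp (π * |t|) / 2) := by
        rw [Real.exp_neg]; field_simp
    _ ≤ 2 * π * Real.exp (-(π * |t|)) * Real.cosh (π * t) := by gcongr
    _ = _ := by congr 3; push_cast; ring

theorem exists_norm_Gamma_half_add_nat_le (m : ℕ) : ∃ C : ℝ, 0 ≤ C ∧ ∀ t : ℝ,
    ‖Complex.Gamma (1 / 2 + t * I + m)‖ ≤ C * (1 + |t|) ^ m * Real.exp (-(π / 2) * |t|) := by
  induction m with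
  | zero => exact ⟨√(2 * π), by positivity, fun t => by simpa using norm_Gamma_half_add_mul_I_le t⟩
  | succ m ih =>
    obtain ⟨C, hC, h⟩ := ih
    refine ⟨C * (m + 1), by positivity, fun t => ?_⟩
    have hre : (1 / 2 + t * I + m : ℂ).re = 1 / 2 + m := by simp
    have hne : (1 / 2 + t * I + m : ℂ) ≠ 0 := fun h0 => by
      rw [h0] at hre; simp at hre; linarith [(Nat.cast_nonneg m : (0 : ℝ) ≤ m)]
    rw [show (1 / 2 + t * I + (m + 1 : ℕ) : ℂ) = (1 / 2 + t * I + m) + 1 by push_cast; ring,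
      Complex.Gamma_add_one _ hne, norm_mul]
    have hn : ‖(1 / 2 + t * I + m : ℂ)‖ ≤ (m + 1) * (1 + |t|) := by
      calc ‖(1 / 2 + t * I + m : ℂ)‖ ≤ ‖(1 / 2 + t * I : ℂ)‖ + ‖(m : ℂ)‖ := norm_add_le _ _
        _ ≤ ‖(1 / 2 : ℂ)‖ + ‖(t * I : ℂ)‖ + ‖(m : ℂ)‖ := by gcongr; exact norm_add_le _ _
        _ = 1 / 2 + |t| + m := by simp
        _ ≤ _ := by nlinarith [abs_nonneg t, (Nat.cast_nonneg m : (0 : ℝ) ≤ m)]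
    calc _ ≤ ((m + 1) * (1 + |t|)) * (C * (1 + |t|) ^ m * Real.exp (-(π / 2) * |t|)) := by
          gcongr; exact h t
      _ = _ := by ring

theorem exists_one_add_abs_pow_mul_exp_le (m : ℕ) {θ θ' : ℝ} (hθ : θ < θ') :
    ∃ C : ℝ, 0 ≤ C ∧ ∀ t : ℝ, (1 + |t|) ^ m * Real.exp (-θ' * |t|) ≤ C * Real.exp (-θ * |t|) := by
  set d := θ' - θ
  have hd : 0 < d := sub_pos.2 hθ
  refine ⟨m.factorial / d ^ m * Real.exp d, by positivity, fun t => ?_⟩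
  have h := Real.pow_div_factorial_le_exp (d * (1 + |t|)) (by positivity) m
  rw [div_le_iff₀ (by positivity), mul_pow] at h
  calc (1 + |t|) ^ m * Real.exp (-θ' * |t|)
      = d ^ m * (1 + |t|) ^ m / d ^ m * Real.exp (-θ' * |t|) := by field_simp
    _ ≤ Real.exp (d * (1 + |t|)) * m.factorial / d ^ m * Real.exp (-θ' * |t|) := by gcongr
    _ = m.factorial / d ^ m * (Real.exp (d * (1 + |t|)) * Real.exp (-θ' * |t|)) := by ring
    _ = m.factorial / d ^ m * (Real.exp d * Real.exp (-θ * |t|)) := by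
      rw [← Real.exp_add, ← Real.exp_add]; congr 2; simp only [d]; ring
    _ = _ := by ring

/-- Exponential decay of `Γ` on closed vertical strips in the right half plane. -/
theorem exists_norm_Gamma_le_of_re_mem_Icc {a b θ : ℝ} (ha : 0 < a) (hθ : θ < π / 2) :
    ∃ C : ℝ, 0 ≤ C ∧ ∀ z : ℂ, z.re ∈ Set.Icc a b →
      ‖Complex.Gamma z‖ ≤ C * Real.exp (-θ * |z.im|) := by
  obtain ⟨m, hm⟩ := exists_nat_gt b
  obtain ⟨C₁, hC₁, h₁⟩ := exists_norm_Gamma_half_add_nat_le m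
  obtain ⟨C₂, hC₂, h₂⟩ := exists_one_add_abs_pow_mul_exp_le m hθ
  have hcont : ContinuousOn Real.Gamma (Set.Icc a b) := fun x hx =>
    (Real.differentiableAt_Gamma fun k => by
      have := hx.1; have := (Nat.cast_nonneg k : (0 : ℝ) ≤ k); linarith).continuousAt.continuousWithinAt
  obtain ⟨K, hK⟩ := (isCompact_Icc.image_of_continuousOn hcont).bddAbove
  have g : 0 < Real.Gamma (1 / 2 + m) := Real.Gamma_pos_of_pos (by positivity)
  refine ⟨|K| / Real.Gamma (1 / 2 + m) * (C₁ * C₂), by positivity, fun z hz => ?_⟩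
  have hz0 : 0 < z.re := ha.trans_le hz.1
  have hb : 0 < 1 / 2 + m - z.re := by linarith [hz.2]
  have h := norm_Gamma_le_of_re_lt hz0 hb
  have e : z + ((1 / 2 + m - z.re : ℝ) : ℂ) = 1 / 2 + z.im * I + m := by
    apply Complex.ext <;> simp
  rw [e, add_sub_cancel] at h
  have hKz : Real.Gamma z.re ≤ |K| := (hK (Set.mem_image_of_mem _ hz)).trans (le_abs_self _)
  calc _ ≤ _ := h
    _ ≤ |K| / Real.Gamma (1 / 2 + m) * (C₁ * (1 + |z.im|) ^ m * Real.exp (-(π / 2) * |z.im|)) := by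
      gcongr; exact h₁ _
    _ = |K| / Real.Gamma (1 / 2 + m) * (C₁ * ((1 + |z.im|) ^ m * Real.exp (-(π / 2) * |z.im|))) := by
      ring
    _ ≤ |K| / Real.Gamma (1 / 2 + m) * (C₁ * (C₂ * Real.exp (-θ * |z.im|))) := by
      exact mul_le_mul_of_nonneg_left (mul_le_mul_of_nonneg_left (h₂ _) hC₁) (by positivity)
    _ = _ := by ring

/-- The filter of `|Im z| → ∞` inside the closed vertical strip `a ≤ Re z ≤ b`. -/
def verticalStrip (a b : ℝ) : Filter ℂ :=
  comap (fun z : ℂ => |z.im|) atTop ⊓ 𝓟 {z : ℂ | z.re ∈ Set.Icc a b}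

theorem eventually_verticalStrip {a b : ℝ} {p : ℂ → Prop} :
    (∀ᶠ z in verticalStrip a b, p z) ↔ ∃ T : ℝ, ∀ z : ℂ, z.re ∈ Set.Icc a b → T ≤ |z.im| → p z := by
  rw [verticalStrip, eventually_inf_principal, eventually_comap, eventually_atTop]
  constructor
  · rintro ⟨T, h⟩
    exact ⟨T, fun z hz hT => h _ hT z rfl hz⟩
  · rintro ⟨T, h⟩
    exact ⟨T, fun t ht z hzt hz => h z hz (hzt ▸ ht)⟩

theorem tendsto_add_verticalStrip (a b : ℝ) (c : ℂ) :
    Tendsto (fun z => c + z) (verticalStrip a b) (verticalStrip (c.re + a) (c.re + b)) := by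
  intro s hs
  obtain ⟨T, hT⟩ := eventually_verticalStrip.1 hs
  refine eventually_verticalStrip.2 ⟨T + |c.im|, fun z hz hzT => hT _ ?_ ?_⟩
  · simpa using hz
  · have := abs_sub_abs_le_abs_sub z.im (-c.im)
    rw [abs_neg, sub_neg_eq_add, add_comm z.im] at this
    rw [add_im]; linarith

theorem tendsto_neg_verticalStrip (a b : ℝ) :
    Tendsto (fun z => -z) (verticalStrip a b) (verticalStrip (-b) (-a)) := by
  intro s hs
  obtain ⟨T, hT⟩ := eventually_verticalStrip.1 hs
  refine eventually_verticalStrip.2 ⟨T, fun z hz hzT => hT _ ?_ ?_⟩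
  · simpa using hz.symm
  · simpa using hzT

theorem exp_abs_im_add_isBigO (θ : ℝ) (c : ℂ) (l : Filter ℂ) :
    (fun z : ℂ => Real.exp (θ * |(c + z).im|)) =O[l] fun z => Real.exp (θ * |z.im|) := by
  refine IsBigO.of_bound (Real.exp (|θ| * |c.im|)) (Eventually.of_forall fun z => ?_)
  rw [Real.norm_of_nonneg (Real.exp_pos _).le, Real.norm_of_nonneg (Real.exp_pos _).le,
    ← Real.exp_add]
  refine Real.exp_le_exp.2 ?_
  have h : |(|(c + z).im| - |z.im|)| ≤ |c.im| := by
    refine (abs_abs_sub_abs_le _ _).trans (le_of_eq ?_)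
    simp
  have h2 : θ * (|(c + z).im| - |z.im|) ≤ |θ| * |c.im| :=
    (le_abs_self _).trans (by rw [abs_mul]; gcongr)
  linarith

theorem Gamma_isBigO_verticalStrip (a b : ℝ) {θ : ℝ} (hθ : θ < π / 2) :
    Complex.Gamma =O[verticalStrip a b] fun z => Real.exp (-θ * |z.im|) := by
  obtain ⟨m, hm⟩ := exists_nat_gt (-a)
  induction m generalizing a b with
  | zero =>
    obtain ⟨C, hC, h⟩ := exists_norm_Gamma_le_of_re_mem_Icc (a := a) (b := b) (by simpa using hm) hθ
    refine IsBigO.of_bound C (eventually_verticalStrip.2 ⟨0, fun z hz _ => ?_⟩)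
    rw [Real.norm_of_nonneg (Real.exp_pos _).le]
    exact h z hz
  | succ m ih =>
    have h1 := (ih (1 + a) (1 + b) (by push_cast at hm; linarith)).comp_tendsto
      (tendsto_add_verticalStrip a b 1)
    refine IsBigO.trans ?_ (h1.trans (exp_abs_im_add_isBigO (-θ) 1 _))
    refine IsBigO.of_bound 1 (eventually_verticalStrip.2 ⟨1, fun z hz hT => ?_⟩)
    have hn : 1 ≤ ‖z‖ := hT.trans (abs_im_le_norm z)
    have h0 : z ≠ 0 := fun h => by simp [h] at hn; linarith
    rw [Function.comp_apply, add_comm, Complex.Gamma_add_one z h0, norm_mul, one_mul]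
    exact le_mul_of_one_le_left (norm_nonneg _) hn

theorem Gamma_add_isBigO_verticalStrip (a b : ℝ) (c : ℂ) {θ : ℝ} (hθ : θ < π / 2) :
    (fun z => Complex.Gamma (c + z)) =O[verticalStrip a b] fun z => Real.exp (-θ * |z.im|) :=
  ((Gamma_isBigO_verticalStrip _ _ hθ).comp_tendsto (tendsto_add_verticalStrip a b c)).trans
    (exp_abs_im_add_isBigO (-θ) c _)

theorem Gamma_sub_isBigO_verticalStrip (a b : ℝ) (c : ℂ) {θ : ℝ} (hθ : θ < π / 2) :
    (fun z => Complex.Gamma (c - z)) =O[verticalStrip a b] fun z => Real.exp (-θ * |z.im|) := by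
  have := (Gamma_add_isBigO_verticalStrip _ _ c hθ).comp_tendsto (tendsto_neg_verticalStrip a b)
  simpa [Function.comp_def, sub_eq_add_neg] using this

theorem cexp_mul_isBigO_verticalStrip (a b : ℝ) (c : ℂ) :
    (fun z => cexp (c * z)) =O[verticalStrip a b] fun z => Real.exp (|c.im| * |z.im|) := by
  refine IsBigO.of_bound (Real.exp (|c.re| * (|a| + |b|)))
    (eventually_verticalStrip.2 ⟨0, fun z hz _ => ?_⟩)
  rw [Real.norm_of_nonneg (Real.exp_pos _).le, Complex.norm_exp, ← Real.exp_add, mul_re]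
  refine Real.exp_le_exp.2 ?_
  have h1 : c.re * z.re ≤ |c.re| * (|a| + |b|) := by
    refine (le_abs_self _).trans ?_
    rw [abs_mul]
    gcongr
    exact (abs_le_max_abs_abs hz.1 hz.2).trans
      (max_le (by linarith [abs_nonneg b]) (by linarith [abs_nonneg a]))
  have h2 : -(c.im * z.im) ≤ |c.im| * |z.im| := by
    rw [← abs_mul]; exact neg_le_abs _
  linarith

theorem pow_isBigO_verticalStrip (a b : ℝ) (j : ℕ) {ε : ℝ} (hε : 0 < ε) :
    (fun z : ℂ => z ^ j) =O[verticalStrip a b] fun z => Real.exp (ε * |z.im|) := by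
  have h1 : (fun z : ℂ => z) =O[verticalStrip a b] fun z => 1 + |z.im| := by
    refine IsBigO.of_bound (1 + (|a| + |b|)) (eventually_verticalStrip.2 ⟨0, fun z hz _ => ?_⟩)
    have h := abs_le_max_abs_abs hz.1 hz.2
    have h' := h.trans
      (max_le (by linarith [abs_nonneg b] : |a| ≤ |a| + |b|) (by linarith [abs_nonneg a]))
    rw [Real.norm_of_nonneg (by positivity)]
    refine (Complex.norm_le_abs_re_add_abs_im z).trans ?_
    nlinarith [abs_nonneg z.im, abs_nonneg a, abs_nonneg b]
  refine (h1.pow j).trans ?_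
  obtain ⟨C, hC, h⟩ := exists_one_add_abs_pow_mul_exp_le j (θ := -ε) (θ' := 0) (by linarith)
  refine IsBigO.of_bound C (Eventually.of_forall fun z => ?_)
  have := h z.im
  rw [Real.norm_of_nonneg (by positivity), Real.norm_of_nonneg (by positivity)]
  simpa using this

theorem integrable_exp_neg_mul_abs {δ : ℝ} (hδ : 0 < δ) :
    Integrable fun t : ℝ => Real.exp (-δ * |t|) := by
  have h₁ : IntegrableOn (fun t : ℝ => Real.exp (-δ * |t|)) (Set.Ioi 0) :=
    (integrableOn_exp_mul_Ioi (neg_lt_zero.2 hδ) 0).congr_fun (fun t ht => by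
      simp only [abs_of_pos (Set.mem_Ioi.1 ht)]) measurableSet_Ioi
  have h₂ : IntegrableOn (fun t : ℝ => Real.exp (-δ * |t|)) (Set.Iic 0) :=
    (integrableOn_exp_mul_Iic hδ 0).congr_fun (fun t ht => by
      simp only [abs_of_nonpos (Set.mem_Iic.1 ht), neg_mul_neg]) measurableSet_Iic
  rw [← integrableOn_univ, ← Set.Iic_union_Ioi (a := (0 : ℝ))]
  exact h₂.union h₁

theorem tendsto_vertical_line {a b σ : ℝ} (hσ : σ ∈ Set.Icc a b) :
    Tendsto (fun t : ℝ => (σ + t * I : ℂ)) (cocompact ℝ) (verticalStrip a b) := by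
  intro s hs
  obtain ⟨T, hT⟩ := eventually_verticalStrip.1 hs
  have : ∀ᶠ t : ℝ in cocompact ℝ, T ≤ |t| :=
    (tendsto_norm_cocompact_atTop (E := ℝ)).eventually_ge_atTop T
  refine mem_map.2 ?_
  filter_upwards [this] with t ht
  exact hT _ (by simpa using hσ) (by simpa using ht)

theorem integrable_vertical {a b σ δ : ℝ} {H : ℂ → ℂ} (hσ : σ ∈ Set.Icc a b)
    (hc : ∀ t : ℝ, ContinuousAt H (σ + t * I)) (hδ : 0 < δ)
    (hO : H =O[verticalStrip a b] fun z => Real.exp (-δ * |z.im|)) :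
    Integrable fun t : ℝ => H (σ + t * I) := by
  have hcont : Continuous fun t : ℝ => H (σ + t * I) :=
    continuous_iff_continuousAt.2 fun t =>
      ContinuousAt.comp (f := fun t : ℝ => (σ + t * I : ℂ)) (hc t) (by fun_prop)
  refine hcont.locallyIntegrable.integrable_of_isBigO_cocompact
    (g := fun t : ℝ => Real.exp (-δ * |t|)) ?_ ((integrable_exp_neg_mul_abs hδ).integrableAtFilter _)
  have := hO.comp_tendsto (tendsto_vertical_line hσ)
  simpa [Function.comp_def] using this

/-- Shifting a vertical contour across a strip of holomorphy. -/
theorem integral_vertical_eq {a b δ : ℝ} {H : ℂ → ℂ} (hab : a ≤ b)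
    (hd : ∀ z : ℂ, z.re ∈ Set.Icc a b → DifferentiableAt ℂ H z) (hδ : 0 < δ)
    (hO : H =O[verticalStrip a b] fun z => Real.exp (-δ * |z.im|)) :
    ∫ t : ℝ, H (a + t * I) = ∫ t : ℝ, H (b + t * I) := by
  have ia := integrable_vertical (Set.left_mem_Icc.2 hab)
    (fun t => (hd _ (by simpa using hab)).continuousAt) hδ hO
  have ib := integrable_vertical (Set.right_mem_Icc.2 hab)
    (fun t => (hd _ (by simpa using hab)).continuousAt) hδ hO
  have ta := intervalIntegral_tendsto_integral ia tendsto_neg_atTop_atBot tendsto_id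
  have tb := intervalIntegral_tendsto_integral ib tendsto_neg_atTop_atBot tendsto_id
  obtain ⟨C, hC⟩ := hO.bound
  obtain ⟨T₀, hT₀⟩ := eventually_verticalStrip.1 hC
  have hdecay : Tendsto (fun T : ℝ => C * Real.exp (-δ * T) * (b - a)) atTop (𝓝 0) := by
    have : Tendsto (fun T : ℝ => Real.exp (-δ * T)) atTop (𝓝 0) :=
      Real.tendsto_exp_atBot.comp (tendsto_id.const_mul_atTop_of_neg (by linarith))
    simpa using (this.const_mul C).mul_const (b - a)
  have hside : ∀ s : ℝ, |s| = 1 →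
      Tendsto (fun T : ℝ => ∫ x in a..b, H (x + (s * T : ℝ) * I)) atTop (𝓝 0) := by
    intro s hs
    refine squeeze_zero_norm' ?_ hdecay
    filter_upwards [eventually_ge_atTop T₀, eventually_ge_atTop 0] with T hT hT'
    have hsT : |s * T| = T := by rw [abs_mul, hs, one_mul, abs_of_nonneg hT']
    have := intervalIntegral.norm_integral_le_of_norm_le_const (a := a) (b := b)
      (f := fun x : ℝ => H (x + (s * T : ℝ) * I)) (C := C * Real.exp (-δ * T)) (by
        intro x hx
        rw [Set.uIoc_of_le hab] at hx
        have := hT₀ (x + (s * T : ℝ) * I) ⟨by simpa using hx.1.le, by simpa using hx.2⟩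
          (by simpa [hsT] using hT)
        rw [Real.norm_of_nonneg (Real.exp_pos _).le] at this
        have him : |((x : ℂ) + (s * T : ℝ) * I).im| = T := by
          rw [show ((x : ℂ) + (s * T : ℝ) * I).im = s * T by simp, hsT]
        rwa [him] at this)
    rwa [abs_of_nonneg (sub_nonneg.2 hab)] at this
  have hrect : ∀ T : ℝ, (∫ y in (-T)..T, H (b + y * I)) - ∫ y in (-T)..T, H (a + y * I)
      = I * ((∫ x in a..b, H (x + ((-1) * T : ℝ) * I)) - ∫ x in a..b, H (x + (1 * T : ℝ) * I)) := by
    intro T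
    have h := Complex.integral_boundary_rect_eq_zero_of_differentiableOn H
      (⟨a, -T⟩ : ℂ) (⟨b, T⟩ : ℂ) (fun z hz => (hd z (by
        have := hz.1
        rwa [Set.mem_preimage, Set.uIcc_of_le hab] at this)).differentiableWithinAt)
    simp only [smul_eq_mul] at h
    simp only [neg_mul, one_mul, ofReal_neg] at h ⊢
    linear_combination (-I) * h + (((∫ y in (-T)..T, H (b + y * I)) - ∫ y in (-T)..T, H (a + y * I))) * Complex.I_sq
  have hlim := ((hside (-1) (by simp)).sub (hside 1 (by simp))).const_mul I
  have hlim' := tb.sub ta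
  have := tendsto_nhds_unique (hlim'.congr fun T => by simpa using hrect T)
    (by simpa using hlim)
  exact (sub_eq_zero.1 this).symm

/-- The trigonometric mode `exp (iπ(2k - n)z)`. -/
noncomputable def trigMode (n : ℕ) (k : Fin (n + 1)) (z : ℂ) : ℂ :=
  cexp (I * π * (2 * (k : ℕ) - n) * z)

/-- The span of the trigonometric modes of degree `n`. -/
noncomputable def trigSpace (n : ℕ) : Submodule ℂ (ℂ → ℂ) :=
  Submodule.span ℂ (Set.range (trigMode n))

theorem trigMode_mem_trigSpace (n : ℕ) (k : Fin (n + 1)) : trigMode n k ∈ trigSpace n :=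
  Submodule.subset_span ⟨k, rfl⟩

theorem differentiable_of_mem_trigSpace {n : ℕ} {q : ℂ → ℂ} (hq : q ∈ trigSpace n) :
    Differentiable ℂ q := by
  induction hq using Submodule.span_induction with
  | mem q hq =>
    obtain ⟨k, rfl⟩ := hq
    unfold trigMode
    fun_prop
  | zero => exact differentiable_const 0
  | add q r _ _ hq hr => exact hq.add hr
  | smul c q _ hq => exact hq.const_smul c

theorem add_one_of_mem_trigSpace {n : ℕ} {q : ℂ → ℂ} (hq : q ∈ trigSpace n) (z : ℂ) :
    q (1 + z) = (-1) ^ n * q z := by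
  induction hq using Submodule.span_induction with
  | mem q hq =>
    obtain ⟨k, rfl⟩ := hq
    have h1 : cexp (-(n * (π * I))) = (-1) ^ n := by
      rw [Complex.exp_neg, Complex.exp_nat_mul, Complex.exp_pi_mul_I, ← inv_pow]; norm_num
    have h2 : cexp ((k : ℕ) * (2 * π * I)) = 1 := Complex.exp_nat_mul_two_pi_mul_I _
    rw [trigMode, trigMode, ← h1, ← Complex.exp_add]
    have h : I * π * (2 * (k : ℕ) - n) * (1 + z) = (k : ℕ) * (2 * π * I)
        + (-(n * (π * I)) + I * π * (2 * (k : ℕ) - n) * z) := by ring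
    rw [h, Complex.exp_add, h2, one_mul]
  | zero => simp
  | add q r _ _ hq hr => simp only [Pi.add_apply, hq, hr]; ring
  | smul c q _ hq => simp only [Pi.smul_apply, hq, smul_eq_mul]; ring

theorem isBigO_of_mem_trigSpace {n : ℕ} {q : ℂ → ℂ} (hq : q ∈ trigSpace n) (a b : ℝ) :
    q =O[verticalStrip a b] fun z => Real.exp (n * π * |z.im|) := by
  induction hq using Submodule.span_induction with
  | mem q hq =>
    obtain ⟨k, rfl⟩ := hq
    refine (cexp_mul_isBigO_verticalStrip a b _).trans (IsBigO.of_bound 1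
      (Eventually.of_forall fun z => ?_))
    rw [Real.norm_of_nonneg (Real.exp_pos _).le, Real.norm_of_nonneg (Real.exp_pos _).le, one_mul]
    refine Real.exp_le_exp.2 (mul_le_mul_of_nonneg_right ?_ (abs_nonneg _))
    have him : (I * π * (2 * (k : ℕ) - n)).im = π * (2 * (k : ℕ) - n) := by simp
    rw [him, abs_mul, abs_of_pos pi_pos, mul_comm]
    have hk : ((k : ℕ) : ℝ) ≤ n := by exact_mod_cast Nat.lt_succ_iff.1 k.2
    refine mul_le_mul_of_nonneg_right (abs_le.2 ⟨?_, ?_⟩) pi_pos.le <;>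
      linarith [(Nat.cast_nonneg (k : ℕ) : (0 : ℝ) ≤ _)]
  | zero => exact isBigO_zero _ _
  | add q r _ _ hq hr => exact hq.add hr
  | smul c q _ hq => exact hq.const_smul_left c

/-- The Gamma weight `∏ Γ(α_b + z) ∏ Γ(β_b - z)`. -/
noncomputable def gammaWeight {n : ℕ} (α : Fin (n + 1) → ℂ) (β : Fin n → ℂ) (z : ℂ) : ℂ :=
  (∏ b, Complex.Gamma (α b + z)) * ∏ b, Complex.Gamma (β b - z)

/-- The integrand of `weightMoment`. -/
noncomputable def weightKernel {n : ℕ} (α : Fin (n + 1) → ℂ) (β : Fin n → ℂ) (q : ℂ → ℂ) (s : ℝ)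
    (p : ℂ[X]) (z : ℂ) : ℂ :=
  p.eval (-z) * q z * gammaWeight α β z * cexp (-s * z)

/-- The Mellin-Barnes moment of `p(-z) q(z)` against the Gamma weight. -/
noncomputable def weightMoment {n : ℕ} (α : Fin (n + 1) → ℂ) (β : Fin n → ℂ) (q : ℂ → ℂ) (s : ℝ)
    (p : ℂ[X]) : ℂ :=
  1 / (2 * π) * ∫ u : ℝ, weightKernel α β q s p (u * I)

theorem polynomial_eval_neg_isBigO_verticalStrip (a b : ℝ) (p : ℂ[X]) {ε : ℝ} (hε : 0 < ε) :
    (fun z : ℂ => p.eval (-z)) =O[verticalStrip a b] fun z => Real.exp (ε * |z.im|) := by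
  induction p using Polynomial.induction_on' with
  | add p q hp hq => simpa using hp.add hq
  | monomial j c =>
    have := ((pow_isBigO_verticalStrip (-b) (-a) j hε).comp_tendsto
      (tendsto_neg_verticalStrip a b)).const_mul_left c
    simpa [Function.comp_def] using this

theorem cexp_neg_mul_isBigO_verticalStrip (a b s : ℝ) :
    (fun z => cexp (-s * z)) =O[verticalStrip a b] fun _ => (1 : ℝ) := by
  simpa using cexp_mul_isBigO_verticalStrip a b (-s)

section

variable {n : ℕ} {α : Fin (n + 1) → ℂ} {β : Fin n → ℂ} {q : ℂ → ℂ}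

theorem gammaWeight_isBigO_verticalStrip (α : Fin (n + 1) → ℂ) (β : Fin n → ℂ) (a b : ℝ)
    {θ : ℝ} (hθ : θ < π / 2) :
    gammaWeight α β =O[verticalStrip a b] fun z => Real.exp (-((2 * n + 1) * θ) * |z.im|) := by
  have h := (IsBigO.finsetProd (s := univ) fun i _ =>
    Gamma_add_isBigO_verticalStrip a b (α i) hθ).mul
    (IsBigO.finsetProd (s := univ) fun i _ => Gamma_sub_isBigO_verticalStrip a b (β i) hθ)
  refine h.congr_right fun z => ?_
  simp only [prod_const, card_univ, Fintype.card_fin, ← Real.exp_nat_mul, ← Real.exp_add]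
  congr 1; push_cast; ring

theorem weightKernel_isBigO_verticalStrip (α : Fin (n + 1) → ℂ) (β : Fin n → ℂ)
    (hq : q ∈ trigSpace n) (s : ℝ) (p : ℂ[X]) (a b : ℝ) :
    weightKernel α β q s p =O[verticalStrip a b] fun z => Real.exp (-(π / 4) * |z.im|) := by
  have hθ : π / 2 - π / 8 / (2 * n + 1) < π / 2 := by
    have : 0 < π / 8 / (2 * n + 1) := by positivity
    linarith
  have h := (((polynomial_eval_neg_isBigO_verticalStrip a b p (ε := π / 8) (by positivity)).mul
    (isBigO_of_mem_trigSpace hq a b)).mul (gammaWeight_isBigO_verticalStrip α β a b hθ)).mul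
    (cexp_neg_mul_isBigO_verticalStrip a b s)
  refine h.congr_right fun z => ?_
  rw [mul_one, ← Real.exp_add, ← Real.exp_add]
  congr 1
  field_simp
  ring

theorem Gamma_differentiableAt_of_re_pos {z : ℂ} (hz : 0 < z.re) :
    DifferentiableAt ℂ Complex.Gamma z :=
  Complex.differentiableAt_Gamma _ fun m h => by
    rw [h] at hz; simp at hz; linarith [(Nat.cast_nonneg m : (0 : ℝ) ≤ m)]

theorem weightKernel_differentiableAt (hq : q ∈ trigSpace n) (s : ℝ) (p : ℂ[X]) {z : ℂ}
    (hα : ∀ b, 0 < (α b).re + z.re) (hβ : ∀ b, z.re < (β b).re) :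
    DifferentiableAt ℂ (weightKernel α β q s p) z := by
  have hq' := differentiable_of_mem_trigSpace hq z
  have h1 : DifferentiableAt ℂ (fun z => ∏ b, Complex.Gamma (α b + z)) z :=
    DifferentiableAt.fun_finsetProd fun b _ =>
      (Gamma_differentiableAt_of_re_pos (by simpa using hα b)).comp z (by fun_prop)
  have h2 : DifferentiableAt ℂ (fun z => ∏ b, Complex.Gamma (β b - z)) z :=
    DifferentiableAt.fun_finsetProd fun b _ =>
      (Gamma_differentiableAt_of_re_pos (by simpa using hβ b)).comp z (by fun_prop)
  have h3 : DifferentiableAt ℂ (fun z => p.eval (-z)) z :=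
    p.differentiable.differentiableAt.comp z (by fun_prop)
  exact ((h3.mul hq').mul (h1.mul h2)).mul (by fun_prop)

theorem integrable_weightKernel (hα : ∀ b, 0 < (α b).re) (hβ : ∀ b, 0 < (β b).re)
    (hq : q ∈ trigSpace n) (s : ℝ) (p : ℂ[X]) :
    Integrable fun u : ℝ => weightKernel α β q s p (u * I) := by
  have := integrable_vertical (a := 0) (b := 0) (σ := 0) (by simp)
    (fun t => (weightKernel_differentiableAt (α := α) (β := β) hq s p
      (by simpa using hα) (by simpa using hβ)).continuousAt) (by positivity)
    (weightKernel_isBigO_verticalStrip α β hq s p 0 0)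
  simpa using this

theorem weightMoment_finset_sum_right {ι : Type*} (hα : ∀ b, 0 < (α b).re)
    (hβ : ∀ b, 0 < (β b).re) (hq : q ∈ trigSpace n) (s : ℝ) (S : Finset ι) (c : ι → ℂ)
    (p : ι → ℂ[X]) :
    weightMoment α β q s (∑ i ∈ S, Polynomial.C (c i) * p i)
      = ∑ i ∈ S, c i * weightMoment α β q s (p i) := by
  have h : ∀ u : ℝ, weightKernel α β q s (∑ i ∈ S, Polynomial.C (c i) * p i) (u * I)
      = ∑ i ∈ S, c i * weightKernel α β q s (p i) (u * I) := fun u => by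
    simp only [weightKernel, Polynomial.eval_finsetSum, Polynomial.eval_mul, Polynomial.eval_C,
      sum_mul, mul_assoc]
  simp only [weightMoment, h]
  rw [integral_finsetSum _ fun i _ => (integrable_weightKernel hα hβ hq s _).const_mul _, mul_sum]
  refine sum_congr rfl fun i _ => ?_
  rw [integral_const_mul]; ring

theorem weightMoment_finset_sum_left {ι : Type*} (hα : ∀ b, 0 < (α b).re)
    (hβ : ∀ b, 0 < (β b).re) (s : ℝ) (p : ℂ[X]) (S : Finset ι) (c : ι → ℂ)
    (q : ι → ℂ → ℂ) (hq : ∀ i, q i ∈ trigSpace n) :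
    weightMoment α β (∑ i ∈ S, c i • q i) s p
      = ∑ i ∈ S, c i * weightMoment α β (q i) s p := by
  have h : ∀ u : ℝ, weightKernel α β (∑ i ∈ S, c i • q i) s p (u * I)
      = ∑ i ∈ S, c i * weightKernel α β (q i) s p (u * I) := fun u => by
    simp only [weightKernel, Finset.sum_apply, Pi.smul_apply, smul_eq_mul, mul_sum, sum_mul]
    exact sum_congr rfl fun i _ => by ring
  simp only [weightMoment, h]
  rw [integral_finsetSum _ fun i _ => (integrable_weightKernel hα hβ (hq i) s _).const_mul _,
    mul_sum]
  refine sum_congr rfl fun i _ => ?_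
  rw [integral_const_mul]; ring

theorem hasDerivAt_weightMoment (hα : ∀ b, 0 < (α b).re) (hβ : ∀ b, 0 < (β b).re)
    (hq : q ∈ trigSpace n) (s : ℝ) (p : ℂ[X]) :
    HasDerivAt (fun s : ℝ => weightMoment α β q s p)
      (weightMoment α β q s (Polynomial.X * p)) s := by
  refine HasDerivAt.const_mul _ ?_
  have hnorm : ∀ (s : ℝ) (u : ℝ), ‖cexp (-s * (u * I))‖ = 1 := fun s u => by
    rw [show -(s : ℂ) * (u * I) = (-(s * u) : ℝ) * I by push_cast; ring,
      Complex.norm_exp_ofReal_mul_I]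
  refine (hasDerivAt_integral_of_dominated_loc_of_deriv_le (s := Set.univ)
    (F := fun s (u : ℝ) => weightKernel α β q s p (u * I))
    (F' := fun s (u : ℝ) => weightKernel α β q s (Polynomial.X * p) (u * I))
    (bound := fun u : ℝ => ‖weightKernel α β q 0 (Polynomial.X * p) (u * I)‖) univ_mem
    (Eventually.of_forall fun s => (integrable_weightKernel hα hβ hq s p).aestronglyMeasurable)
    (integrable_weightKernel hα hβ hq s p)
    (integrable_weightKernel hα hβ hq s _).aestronglyMeasurable
    (Eventually.of_forall fun u s _ => ?_) (integrable_weightKernel hα hβ hq 0 _).norm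
    (Eventually.of_forall fun u s _ => ?_)).2
  · simp only [weightKernel, norm_mul, hnorm, mul_one]
    exact le_of_eq rfl
  · have h : HasDerivAt (fun s : ℝ => cexp (-s * (u * I)))
        (cexp (-s * (u * I)) * (-1 * (u * I))) s :=
      ((((hasDerivAt_id s).ofReal_comp).neg.mul_const (u * I : ℂ)).cexp).congr_deriv (by simp)
    refine (h.const_mul (p.eval (-(u * I)) * q (u * I) * gammaWeight α β (u * I))).congr_deriv ?_
    simp only [weightKernel, Polynomial.eval_mul, Polynomial.eval_X]
    ring

/-- The hypergeometric differential equation, in terms of moments. -/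
theorem weightMoment_prod_eq (hα : ∀ b, 0 < (α b).re) (hβ : ∀ b, 0 < (β b).re)
    (hq : q ∈ trigSpace n) (s : ℝ) :
    weightMoment α β q s (∏ b, (Polynomial.C (α b) - Polynomial.X))
      = (-1) ^ n * cexp s *
        weightMoment α β q s (∏ b, (Polynomial.C (β b) + Polynomial.X)) := by
  have hshift := integral_vertical_eq (a := 0) (b := 1)
    (H := weightKernel α (fun b => β b + 1) q s 1) zero_le_one
    (fun z hz => weightKernel_differentiableAt hq s 1
      (fun b => by linarith [hα b, hz.1])
      (fun b => by have := hβ b; have := hz.2; simp; linarith))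
    (by positivity : 0 < π / 4) (weightKernel_isBigO_verticalStrip _ _ hq s 1 0 1)
  have h0 : ∀ t : ℝ, weightKernel α (fun b => β b + 1) q s 1 ((0 : ℝ) + t * I)
      = weightKernel α β q s (∏ b, (Polynomial.C (β b) + Polynomial.X)) (t * I) := fun t => by
    have : ∀ b, Complex.Gamma (β b + 1 - t * I)
        = (β b - t * I) * Complex.Gamma (β b - t * I) := fun b => by
      rw [← Complex.Gamma_add_one]
      · congr 1; ring
      · intro h
        have h' := congrArg Complex.re h
        simp at h'
        linarith [hβ b]
    simp only [weightKernel, gammaWeight, Polynomial.eval_one, Polynomial.eval_prod, ofReal_zero,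
      zero_add, this, prod_mul_distrib, Polynomial.eval_add, Polynomial.eval_C, Polynomial.eval_X,
      ← sub_eq_add_neg]
    ring
  have h1 : ∀ t : ℝ, weightKernel α (fun b => β b + 1) q s 1 ((1 : ℝ) + t * I)
      = (-1) ^ n * cexp (-s) *
        weightKernel α β q s (∏ b, (Polynomial.C (α b) - Polynomial.X)) (t * I) := fun t => by
    have : ∀ b, Complex.Gamma (α b + (1 + t * I))
        = (α b + t * I) * Complex.Gamma (α b + t * I) := fun b => by
      rw [← Complex.Gamma_add_one]
      · congr 1; ring
      · intro h
        have h' := congrArg Complex.re h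
        simp at h'
        linarith [hα b]
    have he : cexp (-s * (1 + t * I)) = cexp (-s) * cexp (-s * (t * I)) := by
      rw [← Complex.exp_add]; congr 1; ring
    have hb : ∀ b, β b + 1 - (1 + t * I) = β b - t * I := fun b => by ring
    simp only [weightKernel, gammaWeight, Polynomial.eval_one, Polynomial.eval_prod, ofReal_one,
      this, hb, he, add_one_of_mem_trigSpace hq, prod_mul_distrib, Polynomial.eval_sub,
      Polynomial.eval_C, Polynomial.eval_X, sub_neg_eq_add]
    ring
  simp only [h0, h1] at hshift
  rw [integral_const_mul] at hshift
  have hs : ((-1) ^ n * (-1) ^ n : ℂ) = 1 := by rw [← mul_pow]; simp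
  have he : cexp s * cexp (-s) = 1 := by rw [← Complex.exp_add]; simp
  simp only [weightMoment]
  rw [hshift]
  set A := ∫ u : ℝ, weightKernel α β q s (∏ b, (Polynomial.C (α b) - Polynomial.X)) (u * I)
  linear_combination (-(1 / (2 * π) * A) * (cexp s * cexp (-s))) * hs - (1 / (2 * π) * A) * he

end

theorem hasDerivAt_det {m : Type*} [Fintype m] [DecidableEq m] {M : ℝ → Matrix m m ℂ}
    {M' : Matrix m m ℂ} {s : ℝ} (h : ∀ i j, HasDerivAt (fun s => M s i j) (M' i j) s) :
    HasDerivAt (fun s => (M s).det) (∑ i, ((M s).updateRow i (M' i)).det) s := by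
  let f : ContinuousMultilinearMap ℂ (fun _ : m => m → ℂ) ℂ :=
    { toMultilinearMap := (Matrix.detRowAlternating (R := ℂ) (n := m)).toMultilinearMap
      cont := Continuous.matrix_det (A := fun x : m → m → ℂ => (x : Matrix m m ℂ)) continuous_id }
  have hM : HasDerivAt (fun s => (M s : m → m → ℂ)) (M' : m → m → ℂ) s :=
    hasDerivAt_pi.2 fun i => hasDerivAt_pi.2 fun j => h i j
  have := ((f.hasFDerivAt (M s)).restrictScalars ℝ).comp_hasDerivAt s hM
  refine this.congr_deriv ?_
  exact f.linearDeriv_apply _ _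

section

variable {n : ℕ} {α : Fin (n + 1) → ℂ} {β : Fin n → ℂ} {q : ℂ → ℂ}

theorem weightMoment_eq_sum_coeff (hα : ∀ b, 0 < (α b).re) (hβ : ∀ b, 0 < (β b).re)
    (hq : q ∈ trigSpace n) (s : ℝ) {p : ℂ[X]} {N : ℕ} (hp : p.natDegree < N) :
    weightMoment α β q s p
      = ∑ j ∈ range N, p.coeff j * weightMoment α β q s (Polynomial.X ^ j) := by
  conv_lhs => rw [p.as_sum_range_C_mul_X_pow' hp]
  exact weightMoment_finset_sum_right hα hβ hq s _ _ _

theorem exists_weightMoment_recurrence (hα : ∀ b, 0 < (α b).re) (hβ : ∀ b, 0 < (β b).re)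
    (s : ℝ) : ∃ c : Fin (n + 1) → ℂ, c (Fin.last n) = ∑ b, α b - cexp s ∧
      ∀ q ∈ trigSpace n, weightMoment α β q s (Polynomial.X ^ (n + 1))
        = ∑ j, c j * weightMoment α β q s (Polynomial.X ^ (j : ℕ)) := by
  set A : ℂ[X] := ∏ b, (Polynomial.C (α b) - Polynomial.X) with hA
  set B : ℂ[X] := ∏ b, (Polynomial.C (β b) + Polynomial.X) with hB
  set P : ℂ[X] := ∏ b, (Polynomial.X - Polynomial.C (α b)) with hP
  have hAP : A = Polynomial.C ((-1) ^ (n + 1)) * P := by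
    have : ∀ b, Polynomial.C (α b) - Polynomial.X = (-1 : ℂ[X]) * (Polynomial.X - Polynomial.C (α b)) :=
      fun b => by ring
    rw [hA, hP]
    simp only [this, prod_mul_distrib, prod_const, card_univ, Fintype.card_fin]
    simp
  have hPm : P.Monic := Polynomial.monic_prod_of_monic _ _ fun b _ => Polynomial.monic_X_sub_C _
  have hPd : P.natDegree = n + 1 := by
    rw [hP, Polynomial.natDegree_prod_of_monic _ _ fun b _ => Polynomial.monic_X_sub_C _]
    simp
  have hPn : P.coeff n = -∑ b, α b := by
    have := Polynomial.prod_X_sub_C_coeff_card_pred (univ : Finset (Fin (n + 1))) α (by simp)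
    simpa using this
  have hXB : ∀ b, (Polynomial.C (β b) + Polynomial.X).Monic := fun b => by
    rw [add_comm]; exact Polynomial.monic_X_add_C _
  have hBm : B.Monic := Polynomial.monic_prod_of_monic _ _ fun b _ => hXB b
  have hBd : B.natDegree = n := by
    rw [hB, Polynomial.natDegree_prod_of_monic _ _ fun b _ => hXB b]
    simp [add_comm (Polynomial.C _)]
  have hs : ((-1) ^ n * (-1) ^ n : ℂ) = 1 := by rw [← mul_pow]; simp
  refine ⟨fun j => -P.coeff j - cexp s * B.coeff j, ?_, fun q hq => ?_⟩
  · have : B.coeff n = 1 := by rw [← hBd]; exact hBm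
    simp [hPn, this]
  · have h := weightMoment_prod_eq hα hβ hq s
    rw [← hA, ← hB, hAP,
      weightMoment_eq_sum_coeff hα hβ hq s (N := n + 2) (p := _ * P)
        ((Polynomial.natDegree_C_mul_le _ _).trans_lt (by omega)),
      weightMoment_eq_sum_coeff hα hβ hq s (N := n + 2) (p := B) (by omega)] at h
    have hP1 : P.coeff (n + 1) = 1 := by rw [← hPd]; exact hPm
    have hB1 : B.coeff (n + 1) = 0 := Polynomial.coeff_eq_zero_of_natDegree_lt (by omega)
    rw [sum_range_succ, sum_range_succ _ (n + 1), hB1] at h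
    simp only [Polynomial.coeff_C_mul, hP1] at h
    rw [← sum_range (f := fun j => (-P.coeff j - cexp s * B.coeff j)
      * weightMoment α β q s (Polynomial.X ^ j))]
    have e : ∑ j ∈ range (n + 1), (-P.coeff j - cexp s * B.coeff j)
        * weightMoment α β q s (Polynomial.X ^ j)
        = (-1) ^ n * ∑ j ∈ range (n + 1), (-1) ^ (n + 1) * P.coeff j
            * weightMoment α β q s (Polynomial.X ^ j)
          - cexp s * ∑ j ∈ range (n + 1), B.coeff j
            * weightMoment α β q s (Polynomial.X ^ j) := by
      rw [mul_sum, mul_sum, ← sum_sub_distrib]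
      refine sum_congr rfl fun j _ => ?_
      rw [pow_succ]
      linear_combination (P.coeff j * weightMoment α β q s (Polynomial.X ^ j)) * hs
    rw [e]
    have hn : ((-1) ^ (n + 1) : ℂ) = -(-1) ^ n := by rw [pow_succ]; ring
    generalize ∑ j ∈ range (n + 1), (-1) ^ (n + 1) * P.coeff j
      * weightMoment α β q s (Polynomial.X ^ j) = S at h ⊢
    generalize ∑ j ∈ range (n + 1), B.coeff j * weightMoment α β q s (Polynomial.X ^ j) = T at h ⊢
    rw [hn] at h
    linear_combination (-(-1) ^ n) * h
      - (weightMoment α β q s (Polynomial.X ^ (n + 1)) + cexp s * T) * hs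

/-- The Wronskian matrix of a family of Mellin-Barnes integrals. -/
noncomputable def momentMatrix (α : Fin (n + 1) → ℂ) (β : Fin n → ℂ)
    (q : Fin (n + 1) → ℂ → ℂ) (s : ℝ) : Matrix (Fin (n + 1)) (Fin (n + 1)) ℂ :=
  Matrix.of fun j k => weightMoment α β (q k) s (Polynomial.X ^ (j : ℕ))

theorem hasDerivAt_det_momentMatrix (hα : ∀ b, 0 < (α b).re) (hβ : ∀ b, 0 < (β b).re)
    {q : Fin (n + 1) → ℂ → ℂ} (hq : ∀ k, q k ∈ trigSpace n) (s : ℝ) :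
    HasDerivAt (fun s => (momentMatrix α β q s).det)
      ((∑ b, α b - cexp s) * (momentMatrix α β q s).det) s := by
  have h := hasDerivAt_det (M := momentMatrix α β q) (s := s)
    (M' := Matrix.of fun j k => weightMoment α β (q k) s (Polynomial.X ^ ((j : ℕ) + 1)))
    (fun j k => (hasDerivAt_weightMoment hα hβ (hq k) s _).congr_deriv (by
      simp [pow_succ']))
  refine h.congr_deriv ?_
  obtain ⟨c, hc, hrec⟩ := exists_weightMoment_recurrence hα hβ s
  rw [Fin.sum_univ_castSucc, sum_eq_zero, zero_add]
  · have : (Matrix.of fun (j : Fin (n + 1)) k =>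
        weightMoment α β (q k) s (Polynomial.X ^ ((j : ℕ) + 1))) (Fin.last n)
        = ∑ j, c j • momentMatrix α β q s j := by
      ext k
      simp [Finset.sum_apply, hrec _ (hq k), momentMatrix]
    rw [this, Matrix.det_updateRow_sum, hc, smul_eq_mul]
  · intro j _
    refine Matrix.det_zero_of_row_eq (i := j.castSucc) (j := j.succ)
      (Fin.castSucc_lt_succ).ne ?_
    rw [Matrix.updateRow_self, Matrix.updateRow_ne (Fin.castSucc_lt_succ).ne']
    ext k
    simp [momentMatrix]

/-- Abel's identity for the Wronskian. -/
theorem exists_det_momentMatrix_eq (hα : ∀ b, 0 < (α b).re) (hβ : ∀ b, 0 < (β b).re)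
    {q : Fin (n + 1) → ℂ → ℂ} (hq : ∀ k, q k ∈ trigSpace n) :
    ∃ c : ℂ, ∀ s : ℝ,
      (momentMatrix α β q s).det = c * cexp (s * ∑ b, α b) * cexp (-cexp s) := by
  set W := fun s : ℝ => (momentMatrix α β q s).det
  have hd : ∀ s, HasDerivAt (fun s : ℝ => W s * cexp (-(s * ∑ b, α b) + cexp s)) 0 s := by
    intro s
    have h1 := hasDerivAt_det_momentMatrix hα hβ hq s
    have h0 : HasDerivAt (fun s : ℝ => (s : ℂ)) 1 s := (hasDerivAt_id s).ofReal_comp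
    have h2 : HasDerivAt (fun s : ℝ => cexp (-(s * ∑ b, α b) + cexp s))
        (cexp (-(s * ∑ b, α b) + cexp s) * (-∑ b, α b + cexp s)) s :=
      ((h0.mul_const (∑ b, α b)).neg.add h0.cexp).cexp.congr_deriv (by simp)
    refine (h1.mul h2).congr_deriv ?_
    ring
  refine ⟨W 0 * cexp (-((0 : ℝ) * ∑ b, α b) + cexp (0 : ℝ)), fun s => ?_⟩
  have h := is_const_of_deriv_eq_zero (fun s => (hd s).differentiableAt)
    (fun s => (hd s).deriv) s 0
  rw [← h, mul_assoc, mul_assoc, ← Complex.exp_add, ← Complex.exp_add]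
  rw [show -(s * ∑ b, α b) + cexp s + (s * ∑ b, α b + -cexp s) = 0 by ring, Complex.exp_zero,
    mul_one]

end

theorem sin_mul_mem_trigSpace {n : ℕ} {q : ℂ → ℂ} (hq : q ∈ trigSpace n) (c : ℂ) :
    (fun z => Complex.sin (π * (c + z)) * q z) ∈ trigSpace (n + 1) := by
  induction hq using Submodule.span_induction with
  | mem q hq =>
    obtain ⟨k, rfl⟩ := hq
    have h : (fun z => Complex.sin (π * (c + z)) * trigMode n k z)
        = (cexp (-(π * c * I)) * I / 2) • trigMode (n + 1) k.castSucc
          + (-(cexp (π * c * I) * I / 2)) • trigMode (n + 1) k.succ := by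
      ext z
      have h1 : trigMode (n + 1) k.castSucc z = cexp (-(π * z * I)) * trigMode n k z := by
        rw [trigMode, trigMode, ← Complex.exp_add]
        congr 1; push_cast [Fin.val_castSucc]; ring
      have h2 : trigMode (n + 1) k.succ z = cexp (π * z * I) * trigMode n k z := by
        rw [trigMode, trigMode, ← Complex.exp_add]
        congr 1; push_cast [Fin.val_succ]; ring
      simp only [Pi.add_apply, Pi.smul_apply, smul_eq_mul, h1, h2, Complex.sin]
      rw [show -(π * (c + z)) * I = -(π * c * I) + -(π * z * I) by ring,
        show π * (c + z) * I = π * c * I + π * z * I by ring, Complex.exp_add, Complex.exp_add]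
      ring
    rw [h]
    exact add_mem (Submodule.smul_mem _ _ (trigMode_mem_trigSpace _ _))
      (Submodule.smul_mem _ _ (trigMode_mem_trigSpace _ _))
  | zero =>
    convert (trigSpace (n + 1)).zero_mem using 1
    ext z
    simp
  | add q r _ _ hq hr =>
    convert add_mem hq hr using 1
    ext z
    simp only [Pi.add_apply]; ring
  | smul a q _ hq =>
    convert (trigSpace (n + 1)).smul_mem a hq using 1
    ext z
    simp only [Pi.smul_apply, smul_eq_mul]; ring

theorem prod_sin_mem_trigSpace {ι : Type*} [DecidableEq ι] (S : Finset ι) (c : ι → ℂ) :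
    (fun z => ∏ b ∈ S, Complex.sin (π * (c b + z))) ∈ trigSpace #S := by
  induction S using Finset.induction_on with
  | empty =>
    have h : (fun z => ∏ b ∈ (∅ : Finset ι), Complex.sin (π * (c b + z))) = trigMode 0 0 := by
      ext z
      simp [trigMode]
    rw [h]
    exact trigMode_mem_trigSpace 0 0
  | insert a S ha ih =>
    rw [card_insert_of_notMem ha]
    simpa [prod_insert ha] using sin_mul_mem_trigSpace ih (c a)

theorem Gamma_mul_sin_pi_mul {w : ℂ} (hw : ∀ m : ℕ, w ≠ -m) :
    Complex.Gamma w * Complex.sin (π * w) = π * (Complex.Gamma (1 - w))⁻¹ := by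
  have h := Complex.Gamma_mul_Gamma_one_sub w
  have hG := Complex.Gamma_ne_zero hw
  by_cases hs : Complex.sin (π * w) = 0
  · rw [hs, div_zero] at h
    simp [hs, (mul_eq_zero.1 h).resolve_left hG]
  · have hne : Complex.Gamma (1 - w) ≠ 0 := fun h0 => by
      rw [h0, mul_zero, eq_comm, div_eq_zero_iff] at h
      exact h.elim (by exact_mod_cast pi_ne_zero) hs
    field_simp
    rw [eq_div_iff hs] at h
    linear_combination h

theorem ne_neg_nat_of_re_pos {w : ℂ} (hw : 0 < w.re) (m : ℕ) : w ≠ -m := fun h => by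
  rw [h] at hw; simp at hw; linarith [(Nat.cast_nonneg m : (0 : ℝ) ≤ m)]

theorem ne_neg_nat_of_im_ne_zero {w : ℂ} (hw : w.im ≠ 0) (m : ℕ) : w ≠ -m := fun h => by
  rw [h] at hw; simp at hw

theorem integral_Gamma_mul_cexp {c : ℂ} (hc : 0 < c.re) (s : ℝ) :
    1 / (2 * π) * ∫ u : ℝ, Complex.Gamma (c + u * I) * cexp (-s * (u * I))
      = cexp (s * c) * cexp (-cexp s) := by
  have hmel : ∀ y : ℝ, mellin (fun t : ℝ => (Real.exp (-t) : ℂ)) (c.re + y * I)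
      = Complex.Gamma (c.re + y * I) := fun y => by
    rw [Complex.Gamma_eq_integral (by simpa using hc), Complex.GammaIntegral_eq_mellin]
  have hconv : MellinConvergent (fun t : ℝ => (Real.exp (-t) : ℂ)) (c.re : ℂ) := by
    have := Complex.GammaIntegral_convergent (s := (c.re : ℂ)) (by simpa using hc)
    rw [MellinConvergent]
    refine this.congr_fun (fun t _ => ?_) measurableSet_Ioi
    simp [mul_comm]
  have hint : VerticalIntegrable (mellin fun t : ℝ => (Real.exp (-t) : ℂ)) c.re volume := by
    have := integrable_vertical (a := c.re) (b := c.re) (σ := c.re) (H := Complex.Gamma) (by simp)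
      (fun t => (Gamma_differentiableAt_of_re_pos (by simpa using hc)).continuousAt)
      (by positivity : 0 < π / 4) (Gamma_isBigO_verticalStrip _ _ (by linarith [pi_pos]))
    simpa only [VerticalIntegrable, hmel] using this
  have h := mellinInv_mellin_eq c.re (fun t : ℝ => (Real.exp (-t) : ℂ)) (Real.exp_pos s) hconv hint
    (by fun_prop)
  rw [mellinInv] at h
  simp only [hmel] at h
  rw [← integral_add_right_eq_self _ c.im] at h
  have hcpow : ∀ w : ℂ, ((Real.exp s : ℝ) : ℂ) ^ w = cexp (s * w) := fun w => by
    rw [Complex.cpow_def_of_ne_zero (by exact_mod_cast (Real.exp_pos s).ne'),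
      ← Complex.ofReal_log (Real.exp_pos s).le, Real.log_exp]
  have hkey : ∀ u : ℝ, ((Real.exp s : ℝ) : ℂ) ^ (-((c.re : ℂ) + ((u + c.im : ℝ) : ℂ) * I)) •
        Complex.Gamma ((c.re : ℂ) + ((u + c.im : ℝ) : ℂ) * I)
      = cexp (-(s * c)) * (Complex.Gamma (c + u * I) * cexp (-s * (u * I))) := fun u => by
    have e : (c.re : ℂ) + ((u + c.im : ℝ) : ℂ) * I = c + u * I := by
      apply Complex.ext <;> simp [add_comm]
    rw [e, hcpow, smul_eq_mul, show s * -(c + u * I) = -(s * c) + -s * (u * I) by ring,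
      Complex.exp_add]
    ring
  simp only [hkey] at h
  rw [integral_const_mul, Complex.real_smul] at h
  push_cast at h
  rw [← h, mul_left_comm (1 / (2 * (π : ℂ))), ← mul_assoc, ← Complex.exp_add]
  simp

section

variable {n : ℕ} {α : Fin (n + 1) → ℂ} {β : Fin n → ℂ}

/-- The trigonometric function cancelling all towers of poles of the Gamma weight on the left
except the one at `-α k`. -/
noncomputable def sinProd (α : Fin (n + 1) → ℂ) (k : Fin (n + 1)) (z : ℂ) : ℂ :=
  ∏ b ∈ univ.erase k, Complex.sin (π * (α b + z))

theorem sinProd_mem_trigSpace (α : Fin (n + 1) → ℂ) (k : Fin (n + 1)) :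
    sinProd α k ∈ trigSpace n := by
  have h := prod_sin_mem_trigSpace (univ.erase k) α
  rwa [card_erase_of_mem (mem_univ k), card_univ, Fintype.card_fin] at h

theorem tendsto_weightMoment_sinProd (hα : ∀ b, 0 < (α b).re) (hβ : ∀ b, 0 < (β b).re)
    (k : Fin (n + 1)) (j : ℕ) :
    Tendsto (fun s : ℝ => weightMoment α β (sinProd α k) s (Polynomial.X ^ j) * cexp (-(s * α k)))
      atBot (𝓝 (α k ^ j * ((∏ b, Complex.Gamma (β b + α k)) *
        ∏ b ∈ univ.erase k, π * (Complex.Gamma (1 - (α b - α k)))⁻¹))) := by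
  set R : ℂ → ℂ := fun z => (-z) ^ j * ((∏ b, Complex.Gamma (β b - z)) *
    ∏ b ∈ univ.erase k, π * (Complex.Gamma (1 - (α b + z)))⁻¹) with hR
  have hRk : R (-α k) = α k ^ j * ((∏ b, Complex.Gamma (β b + α k)) *
      ∏ b ∈ univ.erase k, π * (Complex.Gamma (1 - (α b - α k)))⁻¹) := by
    simp [hR, sub_eq_add_neg]
  rw [← hRk]
  set U : Set ℂ := {z | ∀ b, z.re < (β b).re} with hU
  have hUo : IsOpen U := by
    rw [hU, Set.ofPred_forall]
    exact isOpen_iInter_of_finite fun b => isOpen_lt Complex.continuous_re continuous_const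
  have hkU : -α k ∈ U := fun b => by simp; linarith [hα k, hβ b]
  have hRd : DifferentiableOn ℂ R U := fun z hz => by
    refine DifferentiableAt.differentiableWithinAt ?_
    have h1 : DifferentiableAt ℂ (fun z => ∏ b, Complex.Gamma (β b - z)) z :=
      DifferentiableAt.fun_finsetProd fun b _ =>
        (Gamma_differentiableAt_of_re_pos (by simpa using hz b)).comp z (by fun_prop)
    have h2 : DifferentiableAt ℂ
        (fun z => ∏ b ∈ univ.erase k, π * (Complex.Gamma (1 - (α b + z)))⁻¹) z :=
      DifferentiableAt.fun_finsetProd fun b _ =>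
        ((Complex.differentiable_one_div_Gamma.differentiableAt).comp z
          (by fun_prop : DifferentiableAt ℂ (fun z => 1 - (α b + z)) z)).const_mul _
    exact DifferentiableAt.mul (by fun_prop) (h1.mul h2)
  have hDd : DifferentiableOn ℂ (dslope R (-α k)) U :=
    (Complex.differentiableOn_dslope (hUo.mem_nhds hkU)).2 hRd
  have hkernel : ∀ (s : ℝ) (z : ℂ), (∀ b (m : ℕ), α b + z ≠ -m) →
      weightKernel α β (sinProd α k) s (Polynomial.X ^ j) z
        = Complex.Gamma (α k + z) * R z * cexp (-s * z) := fun s z hz => by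
    have h : ∏ b ∈ univ.erase k, (π * (Complex.Gamma (1 - (α b + z)))⁻¹)
        = (∏ b ∈ univ.erase k, Complex.Gamma (α b + z)) * sinProd α k z := by
      rw [sinProd, ← prod_mul_distrib]
      exact prod_congr rfl fun b _ => (Gamma_mul_sin_pi_mul (hz b)).symm
    simp only [weightKernel, gammaWeight, hR, h, Polynomial.eval_pow, Polynomial.eval_X,
      ← mul_prod_erase univ (fun b => Complex.Gamma (α b + z)) (mem_univ k)]
    ring
  set G : ℂ → ℂ := fun z => Complex.Gamma (α k + z + 1) * dslope R (-α k) z with hG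
  set H : ℝ → ℂ → ℂ := fun s z => G z * cexp (-s * z) with hH
  have hGeq : ∀ z, α k + z ≠ 0 → G z = Complex.Gamma (α k + z) * (R z - R (-α k)) := by
    intro z hz
    have hz' : z ≠ -α k := fun h => hz (by rw [h]; ring)
    simp only [hG]
    rw [Complex.Gamma_add_one _ hz, dslope_of_ne _ hz', slope_def_field, sub_neg_eq_add,
      add_comm z (α k)]
    field_simp
  have hHeq : ∀ (s : ℝ) (z : ℂ), (∀ b (m : ℕ), α b + z ≠ -m) →
      H s z = weightKernel α β (sinProd α k) s (Polynomial.X ^ j) z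
        - R (-α k) * (Complex.Gamma (α k + z) * cexp (-s * z)) := fun s z hz => by
    rw [hkernel s z hz]
    simp only [hH]
    rw [hGeq z (by simpa using hz k 0)]
    ring
  set a : ℝ := -((α k).re + 1 / 2) with ha
  have ha0 : a ≤ 0 := by linarith [hα k]
  have hHd : ∀ (s : ℝ) (z : ℂ), z.re ∈ Set.Icc a 0 → DifferentiableAt ℂ (H s) z := by
    intro s z hz
    have h1 : DifferentiableAt ℂ (fun z => Complex.Gamma (α k + z + 1)) z :=
      (Gamma_differentiableAt_of_re_pos (by
        have := hz.1; simp only [add_re, one_re]; linarith)).comp z (by fun_prop)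
    have h2 := hDd.differentiableAt (hUo.mem_nhds (show z ∈ U from fun b => hz.2.trans_lt (hβ b)))
    exact (h1.mul h2).mul (by fun_prop)
  have hΓO : ∀ s : ℝ, (fun z => Complex.Gamma (α k + z) * cexp (-s * z))
      =O[verticalStrip a 0] fun z => Real.exp (-(π / 4) * |z.im|) := fun s => by
    simpa using (Gamma_add_isBigO_verticalStrip a 0 (α k) (θ := π / 4)
      (by linarith [pi_pos])).mul (cexp_neg_mul_isBigO_verticalStrip a 0 s)
  have hHO : ∀ s : ℝ, H s =O[verticalStrip a 0] fun z => Real.exp (-(π / 4) * |z.im|) := by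
    intro s
    have h1 := (weightKernel_isBigO_verticalStrip α β (sinProd_mem_trigSpace α k) s
      (Polynomial.X ^ j) a 0).sub ((hΓO s).const_mul_left (R (-α k)))
    refine h1.congr' (eventually_verticalStrip.2 ⟨1 + ∑ b, |(α b).im|, fun z _ hT => ?_⟩)
      EventuallyEq.rfl
    refine (hHeq s z fun b => ne_neg_nat_of_im_ne_zero fun h0 => ?_).symm
    rw [add_im] at h0
    have h2 : |(α b).im| ≤ ∑ b, |(α b).im| :=
      single_le_sum (f := fun b => |(α b).im|) (fun b _ => abs_nonneg _) (mem_univ b)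
    rw [eq_neg_of_add_eq_zero_right h0, abs_neg] at hT
    linarith
  have hline : ∀ t : ℝ, ∀ b (m : ℕ), α b + t * I ≠ -m := fun t b =>
    ne_neg_nat_of_re_pos (by simpa using hα b)
  have hzero : ∀ s : ℝ, 1 / (2 * π) * ∫ t : ℝ, H s ((0 : ℝ) + t * I)
      = weightMoment α β (sinProd α k) s (Polynomial.X ^ j)
        - R (-α k) * (cexp (s * α k) * cexp (-cexp s)) := by
    intro s
    have hi := integrable_vertical (σ := 0) (Set.right_mem_Icc.2 ha0)
      (H := fun z => Complex.Gamma (α k + z) * cexp (-s * z))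
      (fun t => DifferentiableAt.continuousAt (𝕜 := ℂ) (by
        refine DifferentiableAt.mul ((Gamma_differentiableAt_of_re_pos ?_).comp _ (by fun_prop))
          (by fun_prop)
        simpa using hα k)) (by positivity : 0 < π / 4) (hΓO s)
    simp only [ofReal_zero, zero_add] at hi ⊢
    simp only [hHeq s _ (hline _)]
    rw [integral_sub (integrable_weightKernel hα hβ (sinProd_mem_trigSpace α k) s _)
      (hi.const_mul _), integral_const_mul, ← integral_Gamma_mul_cexp (hα k), weightMoment]
    ring
  have hexp0 : Tendsto (fun s : ℝ => cexp (-cexp s)) atBot (𝓝 1) := by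
    have h : Tendsto (fun s : ℝ => cexp (-(Real.exp s : ℂ))) atBot (𝓝 (cexp (-((0 : ℝ) : ℂ)))) :=
      ((by fun_prop : Continuous fun x : ℝ => cexp (-(x : ℂ))).tendsto 0).comp
        Real.tendsto_exp_atBot
    simpa using h
  have hsmall : Tendsto (fun s : ℝ => (1 / (2 * π) * ∫ t : ℝ, H s ((0 : ℝ) + t * I))
      * cexp (-(s * α k))) atBot (𝓝 0) := by
    have hb : Tendsto (fun s : ℝ => 1 / (2 * π) * (∫ t : ℝ, ‖G (a + t * I)‖)
        * Real.exp (s / 2)) atBot (𝓝 0) := by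
      have : Tendsto (fun s : ℝ => Real.exp (s / 2)) atBot (𝓝 0) :=
        Real.tendsto_exp_atBot.comp (tendsto_id.atBot_div_const (by norm_num))
      simpa using this.const_mul (1 / (2 * π) * (∫ t : ℝ, ‖G (a + t * I)‖))
    refine squeeze_zero_norm (fun s => ?_) hb
    rw [← integral_vertical_eq ha0 (hHd s) (by positivity : 0 < π / 4) (hHO s)]
    have hn : ∀ t : ℝ, ‖H s (a + t * I)‖ = ‖G (a + t * I)‖ * Real.exp (-(s * a)) := fun t => by
      simp only [hH]
      rw [norm_mul, Complex.norm_exp]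
      simp
    have h1 : ‖∫ t : ℝ, H s (a + t * I)‖
        ≤ (∫ t : ℝ, ‖G (a + t * I)‖) * Real.exp (-(s * a)) := by
      rw [← integral_mul_const]
      refine (norm_integral_le_integral_norm _).trans (le_of_eq ?_)
      exact integral_congr_ae (Eventually.of_forall hn)
    have h2 : ‖(1 / (2 * π) : ℂ)‖ = 1 / (2 * π) := by
      rw [show (1 / (2 * π) : ℂ) = ((1 / (2 * π) : ℝ) : ℂ) by push_cast; rfl, Complex.norm_real,
        Real.norm_of_nonneg (by positivity)]
    have h3 : ‖cexp (-(s * α k))‖ = Real.exp (-(s * (α k).re)) := by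
      rw [Complex.norm_exp]; simp
    rw [norm_mul, norm_mul, h2, h3]
    calc _ ≤ 1 / (2 * π) * ((∫ t : ℝ, ‖G (a + t * I)‖) * Real.exp (-(s * a)))
          * Real.exp (-(s * (α k).re)) := by gcongr
      _ = 1 / (2 * π) * (∫ t : ℝ, ‖G (a + t * I)‖)
          * (Real.exp (-(s * a)) * Real.exp (-(s * (α k).re))) := by ring
      _ = _ := by
        rw [← Real.exp_add]; congr 2; rw [ha]; ring
  have hsum := hsmall.add (hexp0.const_mul (R (-α k)))
  rw [zero_add, mul_one] at hsum
  refine hsum.congr fun s => ?_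
  rw [hzero]
  have : cexp (s * α k) * cexp (-(s * α k)) = 1 := by rw [← Complex.exp_add]; simp
  linear_combination (-(R (-α k)) * cexp (-cexp s)) * this

end

theorem inv_Gamma_mul_Gamma_neg (d : ℂ) :
    (Complex.Gamma d * Complex.Gamma (-d))⁻¹ * (2 * π * I) = -d * (2 * I * Complex.sin (π * d)) := by
  rcases eq_or_ne d 0 with rfl | hd
  · simp
  have h := Complex.Gamma_mul_Gamma_one_sub d
  rw [sub_eq_neg_add, Complex.Gamma_add_one _ (neg_ne_zero.2 hd)] at h
  have h1 : (Complex.Gamma d * Complex.Gamma (-d)) * -d = π / Complex.sin (π * d) := by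
    rw [← h]; ring
  have hπ : (π : ℂ) ≠ 0 := by exact_mod_cast pi_ne_zero
  rw [← eq_div_iff (neg_ne_zero.2 hd)] at h1
  rw [h1, inv_div, div_div_eq_mul_div]
  field_simp

section

variable {n : ℕ}

/-- The matrix of values of the trigonometric modes at the points `z a`. -/
noncomputable def trigMatrix (z : Fin (n + 1) → ℂ) : Matrix (Fin (n + 1)) (Fin (n + 1)) ℂ :=
  Matrix.of fun a k => trigMode n k (z a)

theorem det_trigMatrix (z : Fin (n + 1) → ℂ) :
    (trigMatrix z).det = ∏ i, ∏ j ∈ Ioi i, (2 * I * Complex.sin (π * (z j - z i))) := by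
  have h : trigMatrix z = Matrix.of fun a k => cexp (-(I * π * z a)) ^ n *
      Matrix.vandermonde (fun a => cexp (2 * I * π * z a)) a k := by
    ext a k
    simp only [trigMatrix, Matrix.of_apply, trigMode, Matrix.vandermonde_apply]
    rw [← Complex.exp_nat_mul, ← Complex.exp_nat_mul, ← Complex.exp_add]
    congr 1; ring
  have hpair : ∀ i j, cexp (2 * I * π * z j) - cexp (2 * I * π * z i)
      = cexp (I * π * z i) * cexp (I * π * z j) * (2 * I * Complex.sin (π * (z j - z i))) := by
    intro i j
    have e : 2 * I * Complex.sin (π * (z j - z i))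
        = cexp (π * (z j - z i) * I) - cexp (-(π * (z j - z i)) * I) := by
      rw [Complex.sin]; linear_combination -(cexp (-(π * (z j - z i)) * I)
        - cexp (π * (z j - z i) * I)) * -I_sq
    rw [e, mul_sub, ← Complex.exp_add, ← Complex.exp_add, ← Complex.exp_add]
    congr 2 <;> ring
  rw [h, Matrix.det_mul_column, Matrix.det_vandermonde]
  simp only [hpair, prod_mul_distrib (s := Ioi _), prod_mul_distrib (s := univ)]
  rw [← prod_mul_distrib (s := univ) (f := fun i => ∏ j ∈ Ioi i, cexp (I * π * z i))]
  simp only [← prod_mul_distrib (s := Ioi _)]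
  rw [prod_prod_Ioi_mul_eq_prod_prod_off_diag (f := fun _ i => cexp (I * π * z i)),
    ← mul_assoc, ← prod_mul_distrib]
  have h1 : ∀ i, cexp (-(I * π * z i)) ^ n * ∏ _j ∈ ({i} : Finset (Fin (n + 1)))ᶜ, cexp (I * π * z i)
      = 1 := by
    intro i
    rw [prod_const, card_compl, card_singleton, Fintype.card_fin, Nat.add_sub_cancel, ← mul_pow,
      ← Complex.exp_add]
    simp
  rw [prod_congr rfl fun i _ => h1 i]
  simp

/-- The interaction of Gamma functions is a product of two Vandermonde determinants. -/
theorem prod_Gamma_sub_inv (z : Fin (n + 1) → ℂ) :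
    (∏ p : Fin (n + 1) × Fin (n + 1) with p.1 ≠ p.2, Complex.Gamma (z p.2 - z p.1))⁻¹ *
        ∏ i : Fin (n + 1), ∏ _j ∈ Ioi i, (2 * π * I)
      = (Matrix.vandermonde fun a => -z a).det * (trigMatrix z).det := by
  have h : ∏ p : Fin (n + 1) × Fin (n + 1) with p.1 ≠ p.2, Complex.Gamma (z p.2 - z p.1)
      = ∏ i, ∏ j ∈ Ioi i, Complex.Gamma (z j - z i) * Complex.Gamma (z i - z j) := by
    rw [prod_prod_Ioi_mul_eq_prod_prod_off_diag (f := fun j i => Complex.Gamma (z j - z i)),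
      prod_filter, ← univ_product_univ, prod_product]
    refine prod_congr rfl fun i _ => ?_
    rw [← prod_filter]
    refine prod_congr ?_ fun _ _ => rfl
    ext j
    simp [eq_comm]
  rw [h, Matrix.det_vandermonde, det_trigMatrix]
  simp only [← prod_inv_distrib, ← prod_mul_distrib]
  refine prod_congr rfl fun i _ => prod_congr rfl fun j _ => ?_
  have := inv_Gamma_mul_Gamma_neg (z j - z i)
  rw [neg_sub] at this
  rw [this]; ring
end

section

variable {n : ℕ} {α : Fin (n + 1) → ℂ} {β : Fin n → ℂ}

theorem det_momentMatrix_of_sub_ne_int (hα : ∀ b, 0 < (α b).re) (hβ : ∀ b, 0 < (β b).re)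
    (hint : ∀ a b, a ≠ b → ∀ m : ℤ, α a - α b ≠ m) (s : ℝ) :
    (momentMatrix α β (trigMode n) s).det
      = (∏ i : Fin (n + 1), ∏ _j ∈ Ioi i, (2 * π * I)) * cexp (s * ∑ b, α b) * cexp (-cexp s)
        * ∏ a, ∏ b, Complex.Gamma (α a + β b) := by
  have hπ : (π : ℂ) ≠ 0 := by exact_mod_cast pi_ne_zero
  have hspan : ∀ k, ∃ c : Fin (n + 1) → ℂ, ∑ j, c j • trigMode n j = sinProd α k := fun k =>
    (Submodule.mem_span_range_iff_exists_fun ℂ).1 (sinProd_mem_trigSpace α k)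
  choose c hc using hspan
  set C : Matrix (Fin (n + 1)) (Fin (n + 1)) ℂ := Matrix.of fun j k => c k j with hC
  have hmul : ∀ s, momentMatrix α β (sinProd α) s = momentMatrix α β (trigMode n) s * C :=
    fun s => by
      ext j k
      simp only [momentMatrix, Matrix.of_apply, Matrix.mul_apply, hC, ← hc k]
      rw [weightMoment_finset_sum_left hα hβ s _ _ _ _ (trigMode_mem_trigSpace n)]
      exact sum_congr rfl fun i _ => mul_comm _ _
  have hdiag : trigMatrix (fun a => -α a) * C
      = Matrix.diagonal fun k => sinProd α k (-α k) := by
    ext a k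
    have h : (trigMatrix (fun a => -α a) * C) a k = sinProd α k (-α a) := by
      simp only [trigMatrix, hC, Matrix.mul_apply, Matrix.of_apply, ← hc k, Finset.sum_apply,
        Pi.smul_apply, smul_eq_mul, mul_comm]
    rw [h, Matrix.diagonal_apply]
    split_ifs with hak
    · rw [hak]
    · exact prod_eq_zero (mem_erase.2 ⟨hak, mem_univ a⟩) (by simp)
  have hD : ∀ k, sinProd α k (-α k) ≠ 0 := fun k => by
    refine prod_ne_zero_iff.2 fun b hb => fun h0 => ?_
    obtain ⟨m, hm⟩ := Complex.sin_eq_zero_iff.1 h0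
    refine hint b k (ne_of_mem_erase hb) m ?_
    rw [mul_comm] at hm
    simpa [sub_eq_add_neg] using mul_right_cancel₀ hπ hm
  have hdet : (trigMatrix fun a => -α a).det * C.det = ∏ k, sinProd α k (-α k) := by
    rw [← Matrix.det_mul, hdiag, Matrix.det_diagonal]
  have hC0 : C.det ≠ 0 := right_ne_zero_of_mul (hdet ▸ prod_ne_zero_iff.2 fun k _ => hD k)
  have hnat : ∀ a b, a ≠ b → ∀ m : ℕ, α a - α b ≠ -m := fun a b hab m => by
    simpa using hint a b hab (-m)
  have hP := prod_Gamma_sub_inv fun a => -α a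
  set P := ∏ p : Fin (n + 1) × Fin (n + 1) with p.1 ≠ p.2, Complex.Gamma (-α p.2 - -α p.1)
  have hPprod : P = ∏ k, ∏ b ∈ univ.erase k, Complex.Gamma (α b - α k) := by
    simp only [P]
    rw [prod_filter, ← univ_product_univ, prod_product_right]
    refine prod_congr rfl fun k _ => ?_
    rw [← prod_filter]
    refine prod_congr ?_ fun b _ => by congr 1; ring
    ext b
    simp
  have hP0 : P ≠ 0 := by
    rw [hPprod]
    exact prod_ne_zero_iff.2 fun k _ => prod_ne_zero_iff.2 fun b hb =>
      Complex.Gamma_ne_zero (hnat b k (ne_of_mem_erase hb))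
  rw [inv_mul_eq_iff_eq_mul₀ hP0] at hP
  obtain ⟨w, hw⟩ := exists_det_momentMatrix_eq hα hβ (sinProd_mem_trigSpace α)
  set L : Fin (n + 1) → ℂ := fun k => (∏ b, Complex.Gamma (β b + α k)) *
    ∏ b ∈ univ.erase k, π * (Complex.Gamma (1 - (α b - α k)))⁻¹ with hL
  have hLprod : ∏ k, L k = (∏ a, ∏ b, Complex.Gamma (α a + β b)) * P *
      ∏ k, sinProd α k (-α k) := by
    rw [hPprod, ← prod_mul_distrib, ← prod_mul_distrib]
    refine prod_congr rfl fun k _ => ?_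
    simp only [hL]
    rw [mul_assoc, sinProd, ← prod_mul_distrib]
    congr 1
    · exact prod_congr rfl fun b _ => by rw [add_comm]
    refine prod_congr rfl fun b hb => ?_
    rw [← Gamma_mul_sin_pi_mul (hnat b k (ne_of_mem_erase hb)), sub_eq_add_neg]
  have hlim : Tendsto (fun s => (momentMatrix α β (sinProd α) s).det * cexp (-(s * ∑ b, α b)))
      atBot (𝓝 ((∏ k, L k) * (Matrix.vandermonde α).det)) := by
    have h : Tendsto (fun s : ℝ => Matrix.of fun j k => cexp (-(s * α k)) *
        momentMatrix α β (sinProd α) s j k) atBot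
        (𝓝 (Matrix.of fun j k => L k * (Matrix.vandermonde α).transpose j k)) := by
      refine tendsto_pi_nhds.2 fun j => tendsto_pi_nhds.2 fun k => ?_
      simpa only [momentMatrix, Matrix.of_apply, Matrix.transpose_apply, Matrix.vandermonde_apply,
        mul_comm] using tendsto_weightMoment_sinProd hα hβ k j
    have h2 := ((continuous_id.matrix_det).tendsto _).comp h
    simp only [Function.comp_def, id, Matrix.det_mul_row, Matrix.det_transpose] at h2
    refine h2.congr fun s => ?_
    rw [← Complex.exp_sum, mul_comm, mul_sum, sum_neg_distrib]
  have hlim2 : Tendsto (fun s => (momentMatrix α β (sinProd α) s).det * cexp (-(s * ∑ b, α b)))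
      atBot (𝓝 w) := by
    have h : Tendsto (fun s : ℝ => w * cexp (-(Real.exp s : ℂ))) atBot
        (𝓝 (w * cexp (-((0 : ℝ) : ℂ)))) :=
      ((by fun_prop : Continuous fun x : ℝ => w * cexp (-(x : ℂ))).tendsto 0).comp
        Real.tendsto_exp_atBot
    simp only [ofReal_zero, neg_zero, Complex.exp_zero, mul_one] at h
    refine h.congr fun s => ?_
    have : cexp (s * ∑ b, α b) * cexp (-(s * ∑ b, α b)) = 1 := by rw [← Complex.exp_add]; simp
    rw [hw, ofReal_exp]
    linear_combination (-w * cexp (-cexp s)) * this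
  have hw' := tendsto_nhds_unique hlim2 hlim
  refine mul_right_cancel₀ hC0 ?_
  rw [← Matrix.det_mul, ← hmul, hw, hw', hLprod, ← hdet, hP]
  simp only [neg_neg]
  ring

end

section

variable {n : ℕ} {α : Fin (n + 1) → ℂ} {β : Fin n → ℂ} {q : ℂ → ℂ}

theorem tendsto_weightMoment_add_mul (hα : ∀ b, 0 < (α b).re) (hβ : ∀ b, 0 < (β b).re)
    (hq : q ∈ trigSpace n) (s : ℝ) (p : ℂ[X]) :
    Tendsto (fun ε : ℝ => weightMoment (fun b => α b + ε * (b : ℕ)) β q s p) (𝓝[>] 0)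
      (𝓝 (weightMoment α β q s p)) := by
  refine Tendsto.const_mul _ ?_
  set θ : ℝ := π / 2 - π / 8 / (2 * n + 1) with hθ
  have hθ1 : θ < π / 2 := by
    have : 0 < π / 8 / (2 * n + 1) := by positivity
    linarith
  have hθ0 : 0 ≤ θ := by
    have : π / 8 / (2 * n + 1) ≤ π / 8 :=
      div_le_self (by positivity) (by linarith [(Nat.cast_nonneg n : (0 : ℝ) ≤ n)])
    linarith [pi_pos]
  choose C hC0 hC using fun b =>
    exists_norm_Gamma_le_of_re_mem_Icc (b := (α b).re + n) (hα b) hθ1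
  set g : ℂ → ℂ := fun z => p.eval (-z) * q z * (∏ b, Complex.Gamma (β b - z)) * cexp (-s * z)
    with hg
  have hker : ∀ (a : Fin (n + 1) → ℂ) z,
      weightKernel a β q s p z = g z * ∏ b, Complex.Gamma (a b + z) := fun a z => by
    simp only [weightKernel, gammaWeight, hg]; ring
  set B : ℂ → ℂ := fun z => g z * ∏ b, ((C b * Real.exp (-θ * |(α b + z).im|) : ℝ) : ℂ) with hB
  have hshift : ∀ c : ℂ, (fun z : ℂ => Real.exp (-θ * |(c + z).im|))
      =O[verticalStrip 0 0] fun z => Real.exp (-θ * |z.im|) := fun c => by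
    refine IsBigO.of_bound (Real.exp (θ * |c.im|)) (Eventually.of_forall fun z => ?_)
    rw [Real.norm_of_nonneg (Real.exp_pos _).le, Real.norm_of_nonneg (Real.exp_pos _).le,
      ← Real.exp_add]
    refine Real.exp_le_exp.2 ?_
    have h : |z.im| ≤ |c.im| + |(c + z).im| := by
      have := abs_sub (c + z).im c.im
      rw [add_im, add_sub_cancel_left] at this
      rw [add_im]; linarith
    nlinarith [mul_le_mul_of_nonneg_left h hθ0]
  have hBO : B =O[verticalStrip 0 0] fun z => Real.exp (-(π / 4) * |z.im|) := by
    have h := ((((polynomial_eval_neg_isBigO_verticalStrip 0 0 p (ε := π / 8) (by positivity)).mul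
      (isBigO_of_mem_trigSpace hq 0 0)).mul
      (IsBigO.finsetProd (s := univ) fun i _ => Gamma_sub_isBigO_verticalStrip 0 0 (β i) hθ1)).mul
      (cexp_neg_mul_isBigO_verticalStrip 0 0 s)).mul
      (IsBigO.finsetProd (s := univ) (f := fun (b : Fin (n + 1)) z =>
        ((C b * Real.exp (-θ * |(α b + z).im|) : ℝ) : ℂ)) fun b _ =>
        IsBigO.of_norm_left (by
          simpa only [Complex.norm_real] using ((hshift (α b)).const_mul_left (C b)).norm_left))
    refine h.congr_right fun z => ?_
    simp only [prod_const, card_univ, Fintype.card_fin, ← Real.exp_nat_mul, ← Real.exp_add, mul_one]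
    congr 1
    rw [hθ]
    push_cast
    field_simp
    ring
  have hBi : Integrable fun u : ℝ => B (u * I) := by
    have := integrable_vertical (a := 0) (b := 0) (σ := 0) (H := B) (by simp) (fun t => ?_)
      (by positivity : 0 < π / 4) hBO
    · simpa using this
    · have h1 : DifferentiableAt ℂ (fun z => ∏ b, Complex.Gamma (β b - z)) (((0 : ℝ) : ℂ) + t * I) :=
        DifferentiableAt.fun_finsetProd fun b _ =>
          (Gamma_differentiableAt_of_re_pos (by simpa using hβ b)).comp _ (by fun_prop)
      have h3 : DifferentiableAt ℂ (fun z => p.eval (-z)) (((0 : ℝ) : ℂ) + t * I) :=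
        p.differentiable.differentiableAt.comp _ (by fun_prop)
      have h4 : DifferentiableAt ℂ g (((0 : ℝ) : ℂ) + t * I) :=
        ((h3.mul (differentiable_of_mem_trigSpace hq _)).mul h1).mul (by fun_prop)
      exact h4.continuousAt.mul (by fun_prop)
  have hpos : ∀ ε : ℝ, 0 ≤ ε → ∀ b : Fin (n + 1), 0 < (α b + ε * (b : ℕ)).re := fun ε hε b => by
    have : 0 ≤ ε * (b : ℕ) := by positivity
    simpa using add_pos_of_pos_of_nonneg (hα b) this
  refine tendsto_integral_filter_of_dominated_convergence (fun u => ‖B (u * I)‖) ?_ ?_ hBi.norm ?_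
  · filter_upwards [self_mem_nhdsWithin] with ε hε
    exact (integrable_weightKernel (hpos ε (le_of_lt hε)) hβ hq s p).aestronglyMeasurable
  · filter_upwards [Ioo_mem_nhdsGT (zero_lt_one' ℝ)] with ε hε
    refine Eventually.of_forall fun u => ?_
    simp only [hker, hB]
    rw [norm_mul (g _), norm_mul (g _), norm_prod, norm_prod]
    gcongr with b _
    rw [Complex.norm_real, Real.norm_of_nonneg (mul_nonneg (hC0 b) (Real.exp_pos _).le)]
    have h1 : (α b + ε * (b : ℕ) + u * I).im = (α b + u * I).im := by simp
    rw [← h1]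
    refine hC b _ ?_
    have h2 : (b : ℝ) ≤ n := by exact_mod_cast Nat.lt_succ_iff.1 b.2
    have h3 : ε * (b : ℕ) ≤ 1 * n := by
      gcongr
      exact hε.2.le
    have h4 : 0 ≤ ε * (b : ℕ) := mul_nonneg hε.1.le (Nat.cast_nonneg _)
    simp only [add_re, mul_re, ofReal_re, ofReal_im, I_re, I_im, natCast_re, natCast_im]
    constructor <;> linarith
  · refine Eventually.of_forall fun u => ?_
    simp only [hker]
    refine Tendsto.const_mul _ (tendsto_finsetProd _ fun b _ => ?_)
    have h := (Gamma_differentiableAt_of_re_pos (z := α b + u * I)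
      (by simpa using hα b)).continuousAt.tendsto
    refine h.comp ?_
    have : Tendsto (fun ε : ℝ => α b + ε * (b : ℕ) + u * I) (𝓝 0)
        (𝓝 (α b + ((0 : ℝ) : ℂ) * (b : ℕ) + u * I)) := Continuous.tendsto (by fun_prop) 0
    simpa using this.mono_left nhdsWithin_le_nhds

theorem eventually_sub_ne_int (α : Fin (n + 1) → ℂ) :
    ∀ᶠ ε : ℝ in 𝓝[>] 0, ∀ a b : Fin (n + 1), a ≠ b → ∀ m : ℤ,
      (α a + ε * (a : ℕ)) - (α b + ε * (b : ℕ)) ≠ m := by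
  refine eventually_all.2 fun a => eventually_all.2 fun b => ?_
  by_cases hab : a = b
  · simp [hab]
  set d : ℝ := (a : ℕ) - (b : ℕ) with hd
  have hd0 : d ≠ 0 := by
    rw [hd, sub_ne_zero]
    exact_mod_cast Fin.val_ne_of_ne hab
  set r : ℝ := (α a - α b).re
  have h : ∀ᶠ t : ℝ in 𝓝[≠] r, ∀ m : ℤ, t ≠ m := by
    have hcl : IsClosed (Set.range ((↑) : ℤ → ℝ) \ {r}) := by
      have hd := Int.isClosedEmbedding_coe_real
      have : Set.range ((↑) : ℤ → ℝ) \ {r} = ((↑) : ℤ → ℝ) '' ((↑) ⁻¹' {r})ᶜ := by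
        rw [← Set.preimage_compl, Set.image_preimage_eq_inter_range, Set.inter_comm]; rfl
      rw [this]
      exact hd.isClosedMap _ (isClosed_discrete _)
    have := hcl.isOpen_compl.mem_nhds (show r ∈ (Set.range ((↑) : ℤ → ℝ) \ {r})ᶜ by simp)
    filter_upwards [mem_nhdsWithin_of_mem_nhds this, self_mem_nhdsWithin] with t ht hne m hm
    exact ht ⟨⟨m, hm.symm⟩, hne⟩
  have hmap : Tendsto (fun ε : ℝ => r + ε * d) (𝓝[>] 0) (𝓝[≠] r) := by
    refine tendsto_nhdsWithin_iff.2 ⟨?_, ?_⟩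
    · have : Tendsto (fun ε : ℝ => r + ε * d) (𝓝 0) (𝓝 (r + 0 * d)) :=
        Continuous.tendsto (by fun_prop) 0
      simpa using this.mono_left nhdsWithin_le_nhds
    · filter_upwards [self_mem_nhdsWithin] with ε hε
      simpa using ⟨(ne_of_gt hε), hd0⟩
  filter_upwards [hmap.eventually h] with ε hε _ m hm
  refine hε m ?_
  have := congr_arg Complex.re hm
  simp at this
  simp only [r, hd, sub_re]
  linarith

theorem det_momentMatrix_trigMode (hα : ∀ b, 0 < (α b).re) (hβ : ∀ b, 0 < (β b).re) (s : ℝ) :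
    (momentMatrix α β (trigMode n) s).det
      = (∏ i : Fin (n + 1), ∏ _j ∈ Ioi i, (2 * π * I)) * cexp (s * ∑ b, α b) * cexp (-cexp s)
        * ∏ a, ∏ b, Complex.Gamma (α a + β b) := by
  have h1 : Tendsto (fun ε : ℝ => momentMatrix (fun b => α b + ε * (b : ℕ)) β (trigMode n) s)
      (𝓝[>] 0) (𝓝 (momentMatrix α β (trigMode n) s)) :=
    tendsto_pi_nhds.2 fun j => tendsto_pi_nhds.2 fun k =>
      tendsto_weightMoment_add_mul hα hβ (trigMode_mem_trigSpace n k) s _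
  have h2 := ((continuous_id.matrix_det).tendsto _).comp h1
  have hadd : ∀ b : Fin (n + 1), Tendsto (fun ε : ℝ => α b + ε * (b : ℕ)) (𝓝[>] 0) (𝓝 (α b)) :=
    fun b => by
      have : Tendsto (fun ε : ℝ => α b + ε * (b : ℕ)) (𝓝 0)
        (𝓝 (α b + ((0 : ℝ) : ℂ) * (b : ℕ))) := Continuous.tendsto (by fun_prop) 0
      simpa using this.mono_left nhdsWithin_le_nhds
  have h3 : Tendsto (fun ε : ℝ => (∏ i : Fin (n + 1), ∏ _j ∈ Ioi i, (2 * π * I)) *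
      cexp (s * ∑ b : Fin (n + 1), (α b + ε * (b : ℕ))) * cexp (-cexp s)
        * ∏ a : Fin (n + 1), ∏ b, Complex.Gamma (α a + ε * (a : ℕ) + β b)) (𝓝[>] 0)
      (𝓝 ((∏ i : Fin (n + 1), ∏ _j ∈ Ioi i, (2 * π * I)) * cexp (s * ∑ b, α b) * cexp (-cexp s)
        * ∏ a, ∏ b, Complex.Gamma (α a + β b))) := by
    refine Tendsto.mul (Tendsto.mul_const _ (Tendsto.const_mul _ ?_))
      (tendsto_finsetProd _ fun a _ => tendsto_finsetProd _ fun b _ => ?_)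
    · exact (Complex.continuous_exp.tendsto _).comp
        ((tendsto_finsetSum _ fun b _ => hadd b).const_mul _)
    · exact (Gamma_differentiableAt_of_re_pos (by
        simpa using add_pos (hα a) (hβ b))).continuousAt.tendsto.comp ((hadd a).add_const _)
  refine tendsto_nhds_unique h2 (h3.congr' ?_)
  filter_upwards [eventually_sub_ne_int α, self_mem_nhdsWithin] with ε hε hpos
  refine (det_momentMatrix_of_sub_ne_int (fun b => ?_) hβ hε s).symm
  have : 0 ≤ ε * (b : ℕ) := mul_nonneg (le_of_lt hpos) (Nat.cast_nonneg _)
  simpa using add_pos_of_pos_of_nonneg (hα b) this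

end

/-- Andréief's identity. -/
theorem integral_det_mul_det {m X : Type*} [Fintype m] [DecidableEq m] [MeasureSpace X]
    [SigmaFinite (volume : Measure X)] (f g : m → X → ℂ)
    (h : ∀ j k, Integrable fun u => f j u * g k u) :
    ∫ t : m → X, (Matrix.of fun a j => f j (t a)).det * (Matrix.of fun a k => g k (t a)).det
      = (Nat.factorial (Fintype.card m)) * (Matrix.of fun j k => ∫ u, f j u * g k u).det := by
  set M : Matrix m m ℂ := Matrix.of fun j k => ∫ u, f j u * g k u with hM
  have hexp : ∀ t : m → X,
      (Matrix.of fun a j => f j (t a)).det * (Matrix.of fun a k => g k (t a)).det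
      = ∑ τ : Equiv.Perm m, ∑ σ : Equiv.Perm m, ((Equiv.Perm.sign τ : ℤ) : ℂ) *
        ((Equiv.Perm.sign σ : ℤ) : ℂ) * ∏ a, f (σ a) (t a) * g (τ a) (t a) := by
    intro t
    rw [← Matrix.det_transpose, ← Matrix.det_transpose (Matrix.of fun a k => g k (t a)),
      Matrix.det_apply', Matrix.det_apply', sum_mul_sum, sum_comm]
    refine sum_congr rfl fun τ _ => sum_congr rfl fun σ _ => ?_
    simp only [Matrix.transpose_apply, Matrix.of_apply, prod_mul_distrib]
    ring
  have hi : ∀ τ σ : Equiv.Perm m, Integrable fun t : m → X => ((Equiv.Perm.sign τ : ℤ) : ℂ) *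
        ((Equiv.Perm.sign σ : ℤ) : ℂ) * ∏ a, f (σ a) (t a) * g (τ a) (t a) := fun τ σ =>
    (Integrable.fintype_prod (f := fun a u => f (σ a) u * g (τ a) u)
      fun a => h (σ a) (τ a)).const_mul _
  have hdet : ∀ τ : Equiv.Perm m, ∑ σ : Equiv.Perm m, ((Equiv.Perm.sign τ : ℤ) : ℂ) *
      ((Equiv.Perm.sign σ : ℤ) : ℂ) * ∏ a, M (σ a) (τ a) = M.det := fun τ => by
    have h1 := Matrix.det_permute' τ M
    rw [Matrix.det_apply'] at h1
    simp only [mul_assoc, ← mul_sum]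
    simp only [Matrix.submatrix_apply, id] at h1
    rw [h1, ← mul_assoc, ← Int.cast_mul, ← Units.val_mul, Int.units_mul_self]
    simp
  simp only [hexp]
  rw [integral_finsetSum _ fun τ _ => integrable_finsetSum _ fun σ _ => hi τ σ]
  simp only [integral_finsetSum _ fun σ _ => hi _ σ, integral_const_mul]
  have hprod : ∀ τ σ : Equiv.Perm m,
      ∫ t : m → X, ∏ a, f (σ a) (t a) * g (τ a) (t a) = ∏ a, M (σ a) (τ a) := fun τ σ =>
    integral_fintype_prod_volume_eq_prod fun a u => f (σ a) u * g (τ a) u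
  simp only [hprod, hdet]
  simp [Fintype.card_perm]

section

variable {n : ℕ} {α : Fin (n + 1) → ℂ} {β : Fin n → ℂ}

theorem integral_prod_gammaWeight_div (hα : ∀ b, 0 < (α b).re) (hβ : ∀ b, 0 < (β b).re) (s : ℝ) :
    ∫ u : Fin (n + 1) → ℝ, (∏ a, gammaWeight α β (u a * I) * cexp (-s * (u a * I))) *
        (∏ p : Fin (n + 1) × Fin (n + 1) with p.1 ≠ p.2,
          Complex.Gamma (u p.2 * I - u p.1 * I))⁻¹
      = (Nat.factorial (n + 1)) * (2 * π) ^ (n + 1) * cexp (s * ∑ b, α b) * cexp (-cexp s)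
        * ∏ a, ∏ b, Complex.Gamma (α a + β b) := by
  have hπ : (π : ℂ) ≠ 0 := by exact_mod_cast pi_ne_zero
  set f : Fin (n + 1) → ℝ → ℂ := fun j u => (-(u * I)) ^ (j : ℕ) with hf
  set g : Fin (n + 1) → ℝ → ℂ := fun k u =>
    (gammaWeight α β (u * I) * cexp (-s * (u * I))) * trigMode n k (u * I) with hg
  have hfg : ∀ j k u, f j u * g k u
      = weightKernel α β (trigMode n k) s (Polynomial.X ^ (j : ℕ)) (u * I) := fun j k u => by
    simp only [hf, hg, weightKernel, Polynomial.eval_pow, Polynomial.eval_X]; ring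
  have hA := integral_det_mul_det f g fun j k => by
    simpa only [hfg] using integrable_weightKernel hα hβ (trigMode_mem_trigSpace n k) s _
  have hM : (Matrix.of fun j k => ∫ u, f j u * g k u)
      = (2 * π : ℂ) • momentMatrix α β (trigMode n) s := by
    ext j k
    simp only [hfg, momentMatrix, weightMoment, Matrix.of_apply, Matrix.smul_apply, smul_eq_mul]
    rw [← mul_assoc, mul_one_div_cancel (mul_ne_zero two_ne_zero hπ), one_mul]
  rw [hM, Matrix.det_smul, Fintype.card_fin, det_momentMatrix_trigMode hα hβ] at hA
  set κ : ℂ := ∏ i : Fin (n + 1), ∏ _j ∈ Ioi i, (2 * π * I) with hκ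
  have hκ0 : κ ≠ 0 := prod_ne_zero_iff.2 fun i _ => prod_ne_zero_iff.2 fun j _ => by
    simp [hπ]
  have hint : ∀ u : Fin (n + 1) → ℝ,
      (Matrix.of fun a j => f j (u a)).det * (Matrix.of fun a k => g k (u a)).det
      = ((∏ a, gammaWeight α β (u a * I) * cexp (-s * (u a * I))) *
        (∏ p : Fin (n + 1) × Fin (n + 1) with p.1 ≠ p.2,
          Complex.Gamma (u p.2 * I - u p.1 * I))⁻¹) * κ := fun u => by
    have h1 : (Matrix.of fun a k => g k (u a)).det
        = (∏ a, gammaWeight α β (u a * I) * cexp (-s * (u a * I))) *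
          (trigMatrix fun a => u a * I).det :=
      Matrix.det_mul_column (fun a => gammaWeight α β (u a * I) * cexp (-s * (u a * I))) _
    have h2 := prod_Gamma_sub_inv fun a => (u a * I : ℂ)
    rw [h1, mul_assoc _ _ κ, h2]
    simp only [hf, Matrix.vandermonde]
    ring
  simp only [hint] at hA
  rw [integral_mul_const] at hA
  refine mul_right_cancel₀ hκ0 (hA.trans ?_)
  ring

end

end

/-- Gustafson's Toda-like limit integral, with the separating contour taken to be
the horizontal line `ℝ + iη` (lying below the upward lattices `y_a + iℏℕ` and above
the downward lattices `x_b - iℏℕ`): for `ℏ > 0`, `s ∈ ℝ`, parameters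
`y : Fin (n+1) → ℂ`, `x : Fin n → ℂ` with `Im x_b < η < Im y_a`, one has
`∫_{(ℝ+iη)^{n+1}} e^{sΣw/(iℏ)} ∏_{a,b} Γ((y_b-w_a)/(iℏ)) ∏_{a,b} Γ((w_a-x_b)/(iℏ))
  / ∏_{a≠b} Γ((w_a-w_b)/(iℏ)) d^{n+1}w/(2πℏ)^{n+1}
 = (n+1)! e^{sΣy/(iℏ)} e^{-e^s} ∏_{a,b} Γ((y_a-x_b)/(iℏ))`. -/
theorem gustafson_limit_integral (ℏ : ℝ) (hℏ : 0 < ℏ) (s : ℝ) (n : ℕ)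
    (y : Fin (n + 1) → ℂ) (x : Fin n → ℂ) (η : ℝ)
    (hy : ∀ a, η < (y a).im) (hx : ∀ b, (x b).im < η) :
    (∫ t : Fin (n + 1) → ℝ,
        Complex.exp (↑s * (∑ a, (↑(t a) + ↑η * Complex.I)) / (Complex.I * ↑ℏ))
          * ((∏ a : Fin (n + 1), ∏ b : Fin (n + 1),
                Complex.Gamma ((y b - (↑(t a) + ↑η * Complex.I)) / (Complex.I * ↑ℏ)))
              * ∏ a : Fin (n + 1), ∏ b : Fin n,
                  Complex.Gamma (((↑(t a) + ↑η * Complex.I) - x b) / (Complex.I * ↑ℏ)))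
          / (∏ p ∈ Finset.univ.filter (fun p : Fin (n + 1) × Fin (n + 1) => p.1 ≠ p.2),
              Complex.Gamma
                (((↑(t p.1) + ↑η * Complex.I) - (↑(t p.2) + ↑η * Complex.I))
                  / (Complex.I * ↑ℏ)))
          / (↑(2 * π * ℏ) : ℂ) ^ (n + 1))
      = ↑(Nat.factorial (n + 1))
        * Complex.exp (↑s * (∑ a, y a) / (Complex.I * ↑ℏ))
        * Complex.exp (-↑(Real.exp s))
        * ∏ a : Fin (n + 1), ∏ b : Fin n,
            Complex.Gamma ((y a - x b) / (Complex.I * ↑ℏ)) := by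
  have hℏ0 : (ℏ : ℂ) ≠ 0 := by exact_mod_cast hℏ.ne'
  have hπ : (π : ℂ) ≠ 0 := by exact_mod_cast pi_ne_zero
  set α : Fin (n + 1) → ℂ := fun b => (y b - η * I) / (I * ℏ) with hαdef
  set β : Fin n → ℂ := fun b => (η * I - x b) / (I * ℏ) with hβdef
  have hre : ∀ z : ℂ, (z / (I * ℏ)).re = z.im / ℏ := fun z => by
    rw [show z / (I * ℏ) = -(z * I) / ℏ by field_simp; linear_combination z * I_sq,
      Complex.div_ofReal_re]
    simp
  have hα : ∀ b, 0 < (α b).re := fun b => by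
    rw [hαdef, hre]
    exact div_pos (by simpa using hy b) hℏ
  have hβ : ∀ b, 0 < (β b).re := fun b => by
    rw [hβdef, hre]
    exact div_pos (by simpa using hx b) hℏ
  have h1 : ∀ (u : ℝ) b, (y b - (((ℏ * u : ℝ) : ℂ) + η * I)) / (I * ℏ) = α b + u * I :=
    fun u b => by
      simp only [hαdef]; push_cast; field_simp; linear_combination (-u * ℏ) * I_sq
  have h2 : ∀ (u : ℝ) b, ((((ℏ * u : ℝ) : ℂ) + η * I) - x b) / (I * ℏ) = β b - u * I :=
    fun u b => by
      simp only [hβdef]; push_cast; field_simp; linear_combination (u * ℏ) * I_sq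
  have h3 : ∀ u v : ℝ, ((((ℏ * u : ℝ) : ℂ) + η * I) - (((ℏ * v : ℝ) : ℂ) + η * I)) / (I * ℏ)
      = v * I - u * I := fun u v => by
    push_cast; field_simp; linear_combination (ℏ * (u - v)) * I_sq
  have h4 : ∀ u : Fin (n + 1) → ℝ, cexp (s * (∑ a, (((ℏ * u a : ℝ) : ℂ) + η * I)) / (I * ℏ))
      = cexp ((n + 1) * (s * η / ℏ)) * ∏ a, cexp (-s * (u a * I)) := fun u => by
    have e : ∑ a, (((ℏ * u a : ℝ) : ℂ) + η * I) = ℏ * ∑ a, (u a : ℂ) + (n + 1) * (η * I) := by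
      simp [sum_add_distrib, mul_sum]
    rw [← Complex.exp_sum, ← Complex.exp_add, ← mul_sum, ← sum_mul, e]
    congr 1
    field_simp
    linear_combination (s * ℏ * ∑ a, (u a : ℂ)) * I_sq
  have h5 : cexp (s * (∑ a, y a) / (I * ℏ))
      = cexp ((n + 1) * (s * η / ℏ)) * cexp (s * ∑ b, α b) := by
    rw [← Complex.exp_add]
    congr 1
    simp only [hαdef, ← sum_div, sum_sub_distrib, sum_const, card_univ, Fintype.card_fin,
      nsmul_eq_mul]
    push_cast
    field_simp
    ring
  have h6 : ∀ a b, (y a - x b) / (I * ℏ) = α a + β b := fun a b => by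
    simp only [hαdef, hβdef]; ring
  have hmain := integral_prod_gammaWeight_div hα hβ s
  set F : (Fin (n + 1) → ℝ) → ℂ := fun t =>
    cexp (↑s * (∑ a, (↑(t a) + ↑η * I)) / (I * ↑ℏ))
          * ((∏ a : Fin (n + 1), ∏ b : Fin (n + 1),
                Complex.Gamma ((y b - (↑(t a) + ↑η * I)) / (I * ↑ℏ)))
              * ∏ a : Fin (n + 1), ∏ b : Fin n,
                  Complex.Gamma (((↑(t a) + ↑η * I) - x b) / (I * ↑ℏ)))
          / (∏ p ∈ Finset.univ.filter (fun p : Fin (n + 1) × Fin (n + 1) => p.1 ≠ p.2),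
              Complex.Gamma (((↑(t p.1) + ↑η * I) - (↑(t p.2) + ↑η * I)) / (I * ↑ℏ)))
          / (↑(2 * π * ℏ) : ℂ) ^ (n + 1) with hF
  have hFu : ∀ u : Fin (n + 1) → ℝ, F (ℏ • u) = cexp ((n + 1) * (s * η / ℏ)) /
      (2 * π * ℏ) ^ (n + 1) * ((∏ a, gammaWeight α β (u a * I) * cexp (-s * (u a * I))) *
        (∏ p : Fin (n + 1) × Fin (n + 1) with p.1 ≠ p.2,
          Complex.Gamma (u p.2 * I - u p.1 * I))⁻¹) := fun u => by
    simp only [hF, Pi.smul_apply, smul_eq_mul, h1, h2, h3, h4, gammaWeight, prod_mul_distrib]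
    push_cast
    ring
  have hscale := Measure.integral_comp_smul_of_nonneg volume F ℏ (hR := hℏ.le)
  simp only [hFu, Module.finrank_fin_fun] at hscale
  rw [integral_const_mul, hmain, Complex.real_smul] at hscale
  change ∫ t, F t = _
  simp only [h5, h6]
  push_cast at hscale ⊢
  rw [eq_comm, inv_mul_eq_iff_eq_mul₀ (pow_ne_zero _ hℏ0)] at hscale
  rw [hscale, mul_pow]
  have : (2 * π : ℂ) ^ (n + 1) ≠ 0 := pow_ne_zero _ (by simp [hπ])
  field_simp
end

section
/- Let ℏ > 0, N ≥ 1, and let u ∈ C_c^∞(ℝ) with ∫_ℝ |u(y)|² dy/(2πℏ) = 1, G ∈ C_c^∞(ℝ^N), and let 𝒯_K(s, y₁,…,y_N) = e^{(π/ℏ)(y₁+…+y_N)(1+N)} / (1 + (K+s)²/ℏ²)^N · ((K+s+i)/(K+s−i))^{(N/(iℏ))(y₁+…+y_N)} · ∏_{a=1}^{N} [Γ(1 + (K+s)/(iℏ)) Γ(1 − (K+s)/(iℏ))] / [Γ((s+K−y_a−Σy)/(iℏ)) Γ((y_a+Σy−s−K)/(iℏ))], where Σy = y₁+…+y_N. Then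 𝒯_K → 1 as K → +∞, uniformly for (s, y) in compact subsets of ℝ × ℝ^N; consequently ∫ |u(s)|² |G(y)|² 𝒯_K(s,y) dμ̃(y) ds/(2πℏ) → ‖G‖²_{L²(dμ̃)}. -/
open MeasureTheory Real Complex Filter Finset

/-- The function `𝒯_K(s, y)` from the isometry proof. -/
noncomputable def Tker (ℏ : ℝ) (N : ℕ) (K s : ℝ) (y : Fin N → ℝ) : ℂ :=
  Complex.exp (((π / ℏ) * (∑ a, y a) * (1 + N) : ℝ) : ℂ)
      / ((1 + (K + s) ^ 2 / ℏ ^ 2 : ℝ) : ℂ) ^ N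
    * ((↑K + ↑s + Complex.I) / (↑K + ↑s - Complex.I))
        ^ ((↑N / (Complex.I * ↑ℏ)) * ↑(∑ a, y a))
    * ∏ a : Fin N,
        (Complex.Gamma (1 + (↑K + ↑s) / (Complex.I * ↑ℏ))
            * Complex.Gamma (1 - (↑K + ↑s) / (Complex.I * ↑ℏ)))
          / (Complex.Gamma ((↑s + ↑K - ↑(y a) - ↑(∑ b, y b)) / (Complex.I * ↑ℏ))
              * Complex.Gamma ((↑(y a) + ↑(∑ b, y b) - ↑s - ↑K) / (Complex.I * ↑ℏ)))

/-- The density of the measure `dμ̃(y) = e^{(π/ℏ)Σy} μ(y) d^N y`. -/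
noncomputable def muTilde (ℏ : ℝ) (N : ℕ) (y : Fin N → ℝ) : ℂ :=
  ↑(Real.exp ((π / ℏ) * ∑ a, y a)) * ((2 * ↑π * ↑ℏ : ℂ) ^ N)⁻¹
    * ∏ p ∈ Finset.univ.filter (fun p : Fin N × Fin N => p.1 ≠ p.2),
        (Complex.Gamma ((↑(y p.1) - ↑(y p.2)) / (Complex.I * ↑ℏ)))⁻¹

/-- Apart from its complex power, `Tker` is the product over `a` of `sinhFactor x d` with
`x = (K + s) / ℏ` and `d = (y a + ∑ b, y b) / ℏ`. -/
noncomputable def sinhFactor (x d : ℝ) : ℝ :=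
  Real.exp (π * d) * (x * (x - d) * Real.sinh (π * (x - d)) / Real.sinh (π * x)) / (1 + x ^ 2)

theorem Gamma_one_add_mul_Gamma_one_sub_neg_I_mul (x : ℝ) (hx : x ≠ 0) :
    Complex.Gamma (1 + -Complex.I * x) * Complex.Gamma (1 - -Complex.I * x)
      = ((π * x / Real.sinh (π * x) : ℝ) : ℂ) := by
  have hx' : (x : ℂ) ≠ 0 := by exact_mod_cast hx
  have hsin : Complex.sin (π * (-Complex.I * x)) = -(Complex.sinh (π * x) * Complex.I) := by
    rw [← Complex.sin_mul_I, ← Complex.sin_neg]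
    congr 1
    ring
  have hsinh : Complex.sinh (π * x) ≠ 0 := by
    have : Real.sinh (π * x) ≠ 0 := by
      rw [Ne, Real.sinh_eq_zero]
      exact mul_ne_zero Real.pi_ne_zero hx
    exact_mod_cast this
  rw [add_comm, Complex.Gamma_add_one _ (mul_ne_zero (neg_ne_zero.2 Complex.I_ne_zero) hx'),
    mul_assoc, Complex.Gamma_mul_Gamma_one_sub, hsin]
  push_cast
  field_simp

theorem Gamma_mul_Gamma_neg_neg_I_mul (v : ℝ) (hv : v ≠ 0) :
    Complex.Gamma (-Complex.I * v) * Complex.Gamma (-(-Complex.I * v))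
      = ((π / (v * Real.sinh (π * v)) : ℝ) : ℂ) := by
  have hv' : (v : ℂ) ≠ 0 := by exact_mod_cast hv
  have hw : -Complex.I * (v : ℂ) ≠ 0 := mul_ne_zero (neg_ne_zero.2 Complex.I_ne_zero) hv'
  have h := Gamma_one_add_mul_Gamma_one_sub_neg_I_mul v hv
  rw [add_comm, Complex.Gamma_add_one _ hw, sub_eq_add_neg, add_comm 1,
    Complex.Gamma_add_one _ (neg_ne_zero.2 hw)] at h
  have hI : Complex.I * Complex.I = -1 := Complex.I_mul_I
  have h2 : (v : ℂ) ^ 2 * (Complex.Gamma (-Complex.I * v) * Complex.Gamma (-(-Complex.I * v)))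
      = (v : ℂ) ^ 2 * ((π / (v * Real.sinh (π * v)) : ℝ) : ℂ) := by
    have h3 : (v : ℂ) ^ 2 * ((π / (v * Real.sinh (π * v)) : ℝ) : ℂ)
        = ((π * v / Real.sinh (π * v) : ℝ) : ℂ) := by
      have : v ^ 2 * (π / (v * Real.sinh (π * v))) = π * v / Real.sinh (π * v) := by
        field_simp
      exact_mod_cast this
    rw [h3, ← h]
    linear_combination ((v : ℂ) ^ 2 * Complex.Gamma (-Complex.I * v)
      * Complex.Gamma (-(-Complex.I * v))) * hI
  exact mul_left_cancel₀ (pow_ne_zero 2 hv') h2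

theorem Tker_eq_cpow_mul_prod_sinhFactor (ℏ : ℝ) (hℏ : 0 < ℏ) (N : ℕ) (K s : ℝ) (y : Fin N → ℝ)
    (hx : K + s ≠ 0) (hv : ∀ a, K + s - (y a + ∑ b, y b) ≠ 0) :
    Tker ℏ N K s y
      = ((↑(K + s) + Complex.I) / (↑(K + s) - Complex.I))
          ^ ((↑N / (Complex.I * ↑ℏ)) * ↑(∑ a, y a))
        * ∏ a : Fin N, ((sinhFactor ((K + s) / ℏ) ((y a + ∑ b, y b) / ℏ) : ℝ) : ℂ) := by
  have hdiv (z : ℝ) : (z : ℂ) / (Complex.I * ℏ) = -Complex.I * ((z / ℏ : ℝ) : ℂ) := by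
    push_cast
    rw [div_mul_eq_div_div, Complex.div_I]
    ring
  have hexp : Complex.exp (((π / ℏ) * (∑ a, y a) * (1 + N) : ℝ) : ℂ)
      = ∏ a : Fin N, ((Real.exp (π * ((y a + ∑ b, y b) / ℏ)) : ℝ) : ℂ) := by
    rw [← Complex.ofReal_exp, ← Complex.ofReal_prod, ← Real.exp_sum, ← Finset.mul_sum,
      ← Finset.sum_div, Finset.sum_add_distrib, Finset.sum_const, Finset.card_univ,
      Fintype.card_fin, nsmul_eq_mul]
    congr 2
    ring
  have hpow : ((1 + (K + s) ^ 2 / ℏ ^ 2 : ℝ) : ℂ) ^ N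
      = ∏ _a : Fin N, ((1 + ((K + s) / ℏ) ^ 2 : ℝ) : ℂ) := by
    rw [Finset.prod_const, Finset.card_univ, Fintype.card_fin, div_pow]
  have hgamma (a : Fin N) :
      (Complex.Gamma (1 + (↑K + ↑s) / (Complex.I * ↑ℏ))
            * Complex.Gamma (1 - (↑K + ↑s) / (Complex.I * ↑ℏ)))
          / (Complex.Gamma ((↑s + ↑K - ↑(y a) - ↑(∑ b, y b)) / (Complex.I * ↑ℏ))
              * Complex.Gamma ((↑(y a) + ↑(∑ b, y b) - ↑s - ↑K) / (Complex.I * ↑ℏ)))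
      = (((K + s) / ℏ * ((K + s) / ℏ - (y a + ∑ b, y b) / ℏ)
          * Real.sinh (π * ((K + s) / ℏ - (y a + ∑ b, y b) / ℏ))
          / Real.sinh (π * ((K + s) / ℏ)) : ℝ) : ℂ) := by
    have h1 : ((K : ℂ) + s) / (Complex.I * ℏ) = -Complex.I * (((K + s) / ℏ : ℝ) : ℂ) := by
      rw [← hdiv]; push_cast; rfl
    have h2 : ((s : ℂ) + K - y a - ↑(∑ b, y b)) / (Complex.I * ℏ)
        = -Complex.I * (((K + s) / ℏ - (y a + ∑ b, y b) / ℏ : ℝ) : ℂ) := by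
      rw [← sub_div, ← hdiv]; push_cast; ring
    have h3 : ((y a : ℂ) + ↑(∑ b, y b) - s - K) / (Complex.I * ℏ)
        = -(-Complex.I * (((K + s) / ℏ - (y a + ∑ b, y b) / ℏ : ℝ) : ℂ)) := by
      rw [← h2]; ring
    rw [h1, h2, h3, Gamma_one_add_mul_Gamma_one_sub_neg_I_mul _ (div_ne_zero hx hℏ.ne'),
      Gamma_mul_Gamma_neg_neg_I_mul _ (by rw [← sub_div]; exact div_ne_zero (hv a) hℏ.ne'),
      ← Complex.ofReal_div]
    congr 1
    rw [div_div_eq_mul_div, div_mul_eq_mul_div, div_div]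
    have := Real.pi_ne_zero
    field_simp
  simp only [Tker]
  rw [hexp, hpow, Finset.prod_congr rfl fun a _ => hgamma a, mul_right_comm,
    ← Finset.prod_div_distrib, ← Finset.prod_mul_distrib, mul_comm]
  congr 1
  · push_cast; rfl
  · refine Finset.prod_congr rfl fun a _ => ?_
    rw [sinhFactor]
    push_cast
    ring

section Limits

variable {α : Type*} {l : Filter α}

theorem tendsto_sinhFactor {x d : α → ℝ} (hx : Tendsto x l atTop)
    (hd : l.IsBoundedUnder (· ≤ ·) (norm ∘ d)) :
    Tendsto (fun q => sinhFactor (x q) (d q)) l (nhds 1) := by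
  have hinv : Tendsto (fun q => (x q)⁻¹) l (nhds 0) := tendsto_inv_atTop_zero.comp hx
  have hdx : Tendsto (fun q => d q * (x q)⁻¹) l (nhds 0) := 
    isBoundedUnder_le_mul_tendsto_zero hd hinv
  obtain ⟨M, hM⟩ := hd
  have hM : ∀ᶠ q in l, ‖d q‖ ≤ M := hM
  have hxd : Tendsto (fun q => x q - d q) l atTop := by
    refine tendsto_atTop_mono' l ?_ (tendsto_atTop_add_const_right l (-M) hx)
    filter_upwards [hM] with q hq
    linarith [(Real.le_norm_self (d q)).trans hq]
  have hE {z : α → ℝ} (hz : Tendsto z l atTop) :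
      Tendsto (fun q => 1 - Real.exp (-(2 * π * z q))) l (nhds 1) := by
    have := Real.tendsto_exp_neg_atTop_nhds_zero.comp
      (hz.const_mul_atTop (by positivity : (0 : ℝ) < 2 * π))
    simpa using this.const_sub 1
  have hlim : Tendsto (fun q => (1 - d q * (x q)⁻¹) / ((x q)⁻¹ ^ 2 + 1)
      * ((1 - Real.exp (-(2 * π * (x q - d q)))) / (1 - Real.exp (-(2 * π * x q))))) l
      (nhds ((1 - 0) / (0 ^ 2 + 1) * (1 / 1))) :=
    ((hdx.const_sub 1).div ((hinv.pow 2).add_const 1) (by norm_num)).mul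
      ((hE hxd).div (hE hx) one_ne_zero)
  norm_num at hlim
  refine hlim.congr' ?_
  filter_upwards [hx.eventually_gt_atTop 0] with q hq
  have hsinh (z : ℝ) :
      Real.sinh (π * z) = Real.exp (π * z) * (1 - Real.exp (-(2 * π * z))) / 2 := by
    rw [Real.sinh_eq, mul_sub, ← Real.exp_add]
    ring_nf
  have hne : 1 - Real.exp (-(2 * π * x q)) ≠ 0 := by
    have : Real.exp (-(2 * π * x q)) < 1 := by
      rw [Real.exp_lt_one_iff, neg_lt_zero]
      positivity
    linarith
  have hadd : Real.exp (π * x q) = Real.exp (π * d q) * Real.exp (π * (x q - d q)) := by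
    rw [← Real.exp_add]; ring_nf
  rw [sinhFactor, hsinh, hsinh, hadd]
  have h1 := Real.exp_ne_zero (π * d q)
  have h2 := Real.exp_ne_zero (π * (x q - d q))
  have h3 : (1 + x q ^ 2) ≠ 0 := by positivity
  generalize Real.exp (-(2 * π * (x q - d q))) = A at *
  generalize Real.exp (-(2 * π * x q)) = B at *
  generalize Real.exp (π * d q) = P at *
  generalize Real.exp (π * (x q - d q)) = Q at *
  field_simp

theorem tendsto_add_I_div_sub_I_cpow {t : α → ℝ} {w : α → ℂ} (ht : Tendsto t l atTop)
    (hw : l.IsBoundedUnder (· ≤ ·) (norm ∘ w)) :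
    Tendsto (fun q => (((t q : ℂ) + Complex.I) / ((t q : ℂ) - Complex.I)) ^ w q) l (nhds 1) := by
  have hinv : Tendsto (fun q => ((t q)⁻¹ : ℂ)) l (nhds 0) := by
    simpa [Function.comp_def] using
      (Complex.continuous_ofReal.tendsto 0).comp (tendsto_inv_atTop_zero.comp ht)
  have hbase : Tendsto (fun q => ((t q : ℂ) + Complex.I) / ((t q : ℂ) - Complex.I)) l
      (nhds 1) := by
    have : Tendsto (fun q => (1 + Complex.I * (t q : ℂ)⁻¹) / (1 - Complex.I * (t q : ℂ)⁻¹)) l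
        (nhds ((1 + Complex.I * 0) / (1 - Complex.I * 0))) :=
      ((hinv.const_mul _).const_add 1).div ((hinv.const_mul _).const_sub 1) (by simp)
    simp only [mul_zero, add_zero, sub_zero, div_one] at this
    refine this.congr' ?_
    filter_upwards [ht.eventually_gt_atTop 0] with q hq
    have hq' : (t q : ℂ) ≠ 0 := by exact_mod_cast hq.ne'
    rw [← mul_div_mul_left _ _ hq']
    congr 1 <;> field_simp
  have hlog : Tendsto (fun q => Complex.log (((t q : ℂ) + Complex.I) / ((t q : ℂ) - Complex.I)))
      l (nhds 0) := by
    simpa using hbase.clog Complex.one_mem_slitPlane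
  have hmul := isBoundedUnder_le_mul_tendsto_zero hw hlog
  have hexp := (Complex.continuous_exp.tendsto 0).comp hmul
  rw [Complex.exp_zero] at hexp
  refine hexp.congr' ?_
  filter_upwards [hbase.eventually_ne one_ne_zero] with q hq
  rw [Complex.cpow_def_of_ne_zero hq, Function.comp_apply, mul_comm]

theorem isBoundedUnder_norm_of_isCompact {β γ E : Type*} [TopologicalSpace β]
    [NormedAddCommGroup E] {C : Set β} (hC : IsCompact C) {f : β → E} (hf : Continuous f)
    (k : Filter γ) :
    (k ×ˢ 𝓟 C).IsBoundedUnder (· ≤ ·) (norm ∘ fun q : γ × β => f q.2) := by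
  obtain ⟨M, hM⟩ := hC.exists_bound_of_continuousOn hf.continuousOn
  refine ⟨M, ?_⟩
  rw [eventually_map]
  filter_upwards [tendsto_snd.eventually (mem_principal_self C)] with q hq using hM _ hq

end Limits

theorem tendstoUniformlyOn_Tker (ℏ : ℝ) (hℏ : 0 < ℏ) (N : ℕ) (C : Set (ℝ × (Fin N → ℝ)))
    (hC : IsCompact C) :
    TendstoUniformlyOn (fun (K : ℝ) (p : ℝ × (Fin N → ℝ)) => Tker ℏ N K p.1 p.2)
      (fun _ => 1) atTop C := by
  rw [← tendsto_prod_principal_iff]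
  have ht : Tendsto (fun q : ℝ × ℝ × (Fin N → ℝ) => q.1 + q.2.1) (atTop ×ˢ 𝓟 C) atTop := by
    obtain ⟨M, hM⟩ := isBoundedUnder_norm_of_isCompact hC continuous_fst (atTop : Filter ℝ)
    have hM : ∀ᶠ q : ℝ × ℝ × (Fin N → ℝ) in atTop ×ˢ 𝓟 C, ‖q.2.1‖ ≤ M := hM
    refine tendsto_atTop_mono' _ ?_ (tendsto_atTop_add_const_right _ (-M) tendsto_fst)
    filter_upwards [hM] with q hq
    linarith [neg_le_of_abs_le hq]
  have hd (a : Fin N) : (atTop ×ˢ 𝓟 C : Filter (ℝ × ℝ × (Fin N → ℝ))).IsBoundedUnder (· ≤ ·)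
      (norm ∘ fun q => (q.2.2 a + ∑ b, q.2.2 b) / ℏ) :=
    isBoundedUnder_norm_of_isCompact hC
      (f := fun p : ℝ × (Fin N → ℝ) => (p.2 a + ∑ b, p.2 b) / ℏ) (by fun_prop) atTop
  have hw : (atTop ×ˢ 𝓟 C : Filter (ℝ × ℝ × (Fin N → ℝ))).IsBoundedUnder (· ≤ ·)
      (norm ∘ fun q => ((N : ℂ) / (Complex.I * ℏ)) * ((∑ a, q.2.2 a : ℝ) : ℂ)) :=
    isBoundedUnder_norm_of_isCompact hC
      (f := fun p : ℝ × (Fin N → ℝ) => ((N : ℂ) / (Complex.I * ℏ)) * ((∑ a, p.2 a : ℝ) : ℂ))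
      (by fun_prop) atTop
  have hx := ht.atTop_div_const hℏ
  have hprod : Tendsto (fun q : ℝ × ℝ × (Fin N → ℝ) => ∏ a : Fin N,
      ((sinhFactor ((q.1 + q.2.1) / ℏ) ((q.2.2 a + ∑ b, q.2.2 b) / ℏ) : ℝ) : ℂ))
      (atTop ×ˢ 𝓟 C) (nhds (∏ _a : Fin N, ((1 : ℝ) : ℂ))) :=
    tendsto_finsetProd _ fun a _ =>
      (Complex.continuous_ofReal.tendsto 1).comp (tendsto_sinhFactor hx (hd a))
  have hlim := (tendsto_add_I_div_sub_I_cpow ht hw).mul hprod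
  simp only [Complex.ofReal_one, Finset.prod_const_one, mul_one] at hlim
  refine hlim.congr' ?_
  have hv : ∀ᶠ q : ℝ × ℝ × (Fin N → ℝ) in atTop ×ˢ 𝓟 C,
      ∀ a, q.1 + q.2.1 - (q.2.2 a + ∑ b, q.2.2 b) ≠ 0 := by
    rw [eventually_all]
    intro a
    obtain ⟨M, hM⟩ := hd a
    have hM : ∀ᶠ q : ℝ × ℝ × (Fin N → ℝ) in atTop ×ˢ 𝓟 C,
      ‖(q.2.2 a + ∑ b, q.2.2 b) / ℏ‖ ≤ M := hM
    filter_upwards [hM, hx.eventually_gt_atTop M] with q hq hqx h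
    have h' := (le_abs_self _).trans hq
    rw [← sub_eq_zero.1 h] at h'
    linarith
  filter_upwards [hv, ht.eventually_gt_atTop 0] with q hq hq0
  exact (Tker_eq_cpow_mul_prod_sinhFactor ℏ hℏ N q.1 q.2.1 q.2.2 hq0.ne' hq).symm

theorem measurable_complex_Gamma : Measurable Complex.Gamma := by
  have h := Complex.differentiable_one_div_Gamma.continuous.measurable.inv
  have h' : (fun z => (Complex.Gamma z)⁻¹)⁻¹ = Complex.Gamma := by
    ext z
    simp
  rwa [h'] at h

theorem measurable_Tker (ℏ : ℝ) (N : ℕ) (K : ℝ) :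
    Measurable fun p : ℝ × (Fin N → ℝ) => Tker ℏ N K p.1 p.2 := by
  have hG := measurable_complex_Gamma
  unfold Tker
  fun_prop

theorem continuous_muTilde (ℏ : ℝ) (N : ℕ) : Continuous (muTilde ℏ N) := by
  have hG : Continuous fun z : ℂ => (Complex.Gamma z)⁻¹ :=
    Complex.differentiable_one_div_Gamma.continuous
  unfold muTilde
  refine Continuous.mul (by fun_prop) (continuous_finsetProd _ fun p _ => hG.comp ?_)
  fun_prop

theorem tendsto_integral_mul_of_tendstoUniformlyOn {X : Type*} [TopologicalSpace X]
    [MeasurableSpace X] [OpensMeasurableSpace X] {ν : Measure X} [IsFiniteMeasureOnCompacts ν]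
    {F : ℝ → X → ℂ} {f : X → ℂ}
    (hf : Continuous f) (hfc : HasCompactSupport f) (hF : ∀ K, Measurable (F K))
    (hlim : TendstoUniformlyOn F (fun _ => 1) atTop (tsupport f)) :
    Tendsto (fun K => ∫ p, f p * F K p ∂ν) atTop (nhds (∫ p, f p ∂ν)) := by
  have hfi : Integrable f ν := hf.integrable_of_hasCompactSupport hfc
  refine tendsto_integral_filter_of_dominated_convergence (fun p => ‖f p‖ * 2) ?_ ?_
    (hfi.norm.mul_const 2) ?_
  · exact .of_forall fun K => hfi.aestronglyMeasurable.mul (hF K).aestronglyMeasurable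
  · filter_upwards [Metric.tendstoUniformlyOn_iff.1 hlim 1 one_pos] with K hK
    refine .of_forall fun p => ?_
    rw [norm_mul]
    by_cases hp : p ∈ tsupport f
    · gcongr
      have h := hK p hp
      rw [dist_comm, dist_eq_norm] at h
      have := norm_le_norm_add_norm_sub' (F K p) 1
      rw [norm_one] at this
      linarith
    · simp [image_eq_zero_of_notMem_tsupport hp]
  · refine .of_forall fun p => ?_
    by_cases hp : p ∈ tsupport f
    · simpa using (hlim.tendsto_at hp).const_mul (f p)
    · simp [image_eq_zero_of_notMem_tsupport hp]

/-- `𝒯_K → 1` uniformly on compact subsets of `ℝ × ℝ^N` as `K → +∞`, and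
consequently `∫ |u(s)|² |G(y)|² 𝒯_K(s,y) dμ̃(y) ds/(2πℏ) → ‖G‖²_{L²(dμ̃)}`. -/
theorem Tker_limit (ℏ : ℝ) (hℏ : 0 < ℏ) (N : ℕ) (hN : 0 < N)
    (u : ℝ → ℂ) (hu₁ : ContDiff ℝ (⊤ : ℕ∞) u) (hu₂ : HasCompactSupport u)
    (hu₃ : (∫ s : ℝ, ‖u s‖ ^ 2 / (2 * π * ℏ)) = 1)
    (G : (Fin N → ℝ) → ℂ) (hG₁ : ContDiff ℝ (⊤ : ℕ∞) G) (hG₂ : HasCompactSupport G) :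
    (∀ C : Set (ℝ × (Fin N → ℝ)), IsCompact C →
      TendstoUniformlyOn (fun (K : ℝ) (p : ℝ × (Fin N → ℝ)) => Tker ℏ N K p.1 p.2)
        (fun _ => 1) atTop C)
    ∧ Tendsto
        (fun K : ℝ =>
          ∫ p : ℝ × (Fin N → ℝ),
            ↑(‖u p.1‖ ^ 2) * ↑(‖G p.2‖ ^ 2) * Tker ℏ N K p.1 p.2 * muTilde ℏ N p.2
              / (2 * ↑π * ↑ℏ : ℂ))
        atTop
        (nhds (∫ y : Fin N → ℝ, ↑(‖G y‖ ^ 2) * muTilde ℏ N y)) := by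
  refine ⟨tendstoUniformlyOn_Tker ℏ hℏ N, ?_⟩
  set f : ℝ × (Fin N → ℝ) → ℂ := fun p =>
    ((‖u p.1‖ ^ 2 / (2 * π * ℏ) : ℝ) : ℂ) * (((‖G p.2‖ ^ 2 : ℝ) : ℂ) * muTilde ℏ N p.2) with hf
  have hu := hu₁.continuous
  have hG := hG₁.continuous
  have hμ := continuous_muTilde ℏ N
  have hfc : Continuous f := by fun_prop
  have hfs : HasCompactSupport f := by
    refine HasCompactSupport.intro (hu₂.isCompact.prod hG₂.isCompact) fun p hp => ?_
    rw [Set.mem_prod, not_and_or] at hp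
    rcases hp with hp | hp
    · simp [hf, image_eq_zero_of_notMem_tsupport hp]
    · simp [hf, image_eq_zero_of_notMem_tsupport hp]
  have hint : ∫ p, f p = ∫ y : Fin N → ℝ, ↑(‖G y‖ ^ 2) * muTilde ℏ N y := by
    rw [hf, Measure.volume_eq_prod,
      integral_prod_mul (fun s : ℝ => ((‖u s‖ ^ 2 / (2 * π * ℏ) : ℝ) : ℂ))
        (fun y : Fin N → ℝ => ((‖G y‖ ^ 2 : ℝ) : ℂ) * muTilde ℏ N y),
      integral_complex_ofReal, hu₃, Complex.ofReal_one, one_mul]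
  rw [← hint]
  refine (tendsto_integral_mul_of_tendstoUniformlyOn (ν := (volume : Measure ℝ).prod volume)
    hfc hfs (measurable_Tker ℏ N) (tendstoUniformlyOn_Tker ℏ hℏ N _ hfs.isCompact)).congr
    fun K => integral_congr_ae (.of_forall fun p => ?_)
  simp only [hf]
  push_cast
  ring
end
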